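/- arXiv:1904.01055 — 2 statements merged into one kernel-verified Lean document; each statement's English description precedes it below -/
import Mathlib

section
/- There is an absolute constant α > 0 such that the following holds. Let H be a graph on r vertices and let G be an H-minor-free simple graph on n vertices with maximum degree at most d. Then for every integer ℓ ≥ α·r³, there are at least (1 − 1/ℓ)·n vertices v of G such that ‖clip(p_v^ℓ, 3/8)‖₂² ≥ ℓ^{−7}. -/
open scoped Classical

noncomputable section

/-- Transition matrix of the lazy random walk on `G` with step probability `1/(2d)`. -/
def lazyStep {V : Type*} [Fintype V] [DecidableEq V] (G : SimpleGraph V) [DecidableRel G.Adj]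
    (d : ℕ) : Matrix V V ℝ :=
  Matrix.of fun u v =>
    if G.Adj u v then 1 / (2 * d)
    else if u = v then 1 - (G.degree u : ℝ) / (2 * d)
    else 0

/-- `walkDist G d t s v` is the probability that the `t`-step lazy random walk from `s` ends
at `v`. -/
def walkDist {V : Type*} [Fintype V] [DecidableEq V] (G : SimpleGraph V) [DecidableRel G.Adj]
    (d t : ℕ) (s : V) : V → ℝ :=
  fun v => (lazyStep G d ^ t) s v

/-- The squared `ξ`-clipped `ℓ₂`-norm of a nonnegative vector `x`: the least squared `ℓ₂`-norm
of a vector `y` with `0 ≤ y ≤ x` entrywise and `‖x - y‖₁ ≤ ξ`. -/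
def clipNormSq {W : Type*} [Fintype W] (x : W → ℝ) (ξ : ℝ) : ℝ :=
  sInf { r : ℝ | ∃ y : W → ℝ, (∀ v, 0 ≤ y v ∧ y v ≤ x v) ∧ (∑ v, |x v - y v|) ≤ ξ ∧
    r = ∑ v, y v ^ 2 }

/-- `G` contains an `H`-minor: there are disjoint nonempty connected branch sets in `G`,
one for each vertex of `H`, with adjacent branch sets for each edge of `H`. -/
def HasMinor {V W : Type*} (G : SimpleGraph V) (H : SimpleGraph W) : Prop :=
  ∃ B : W → Set V,
    (∀ w, (B w).Nonempty) ∧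
    (∀ w, (G.induce (B w)).Connected) ∧
    (Pairwise fun w w' => Disjoint (B w) (B w')) ∧
    ∀ w w', H.Adj w w' → ∃ u ∈ B w, ∃ v ∈ B w', G.Adj u v


/-- A family of pairwise disjoint, pairwise adjacent connected vertex sets, i.e. a model of a
complete minor. -/
structure IsCliqueModel {V : Type*} (G : SimpleGraph V) (B : Finset (Finset V)) : Prop where
  connected : ∀ b ∈ B, (G.induce (b : Set V)).Connected
  disjoint : ∀ b ∈ B, ∀ c ∈ B, b ≠ c → Disjoint b c
  adj : ∀ b ∈ B, ∀ c ∈ B, b ≠ c → ∃ u ∈ b, ∃ v ∈ c, G.Adj u v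

theorem IsCliqueModel.hasMinor {V : Type*} {G : SimpleGraph V} {B : Finset (Finset V)}
    (hB : IsCliqueModel G B) {r : ℕ} (hr : r ≤ B.card) (H : SimpleGraph (Fin r)) :
    HasMinor G H := by
  obtain ⟨e⟩ : Nonempty (Fin r ↪ B) := Function.Embedding.nonempty_of_card_le (by simpa using hr)
  have hne : ∀ {i j}, i ≠ j → (e i : Finset V) ≠ e j := fun h h' => h (e.injective (Subtype.ext h'))
  refine ⟨fun i => ((e i : Finset V) : Set V), fun i => ?_, fun i => hB.connected _ (e i).2,
    fun i j hij => ?_, fun i j hij => ?_⟩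
  · obtain ⟨x⟩ := (hB.connected _ (e i).2).nonempty
    exact ⟨x.1, x.2⟩
  · exact Finset.disjoint_coe.2 (hB.disjoint _ (e i).2 _ (e j).2 (hne hij))
  · exact hB.adj _ (e i).2 _ (e j).2 (hne hij.ne)

/-- The vertices of `W` outside `D` that have a neighbour in `D`. -/
def outerBoundary {V : Type*} (G : SimpleGraph V) (W D : Finset V) : Finset V :=
  W.filter fun x => x ∉ D ∧ ∃ y ∈ D, G.Adj y x

theorem mem_outerBoundary {V : Type*} {G : SimpleGraph V} {W D : Finset V} {x : V} :
    x ∈ outerBoundary G W D ↔ x ∈ W ∧ x ∉ D ∧ ∃ y ∈ D, G.Adj y x :=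
  Finset.mem_filter

theorem induce_singleton_connected {V : Type*} (G : SimpleGraph V) (v : V) :
    (G.induce ({v} : Set V)).Connected :=
  { preconnected := SimpleGraph.Preconnected.of_subsingleton }

theorem induce_insert_connected {V : Type*} [DecidableEq V] {G : SimpleGraph V} {P : Finset V}
    (hP : (G.induce (P : Set V)).Connected) {x y : V} (hy : y ∈ P) (hxy : G.Adj y x) :
    (G.induce ((insert x P : Finset V) : Set V)).Connected := by
  have := SimpleGraph.connected_induce_union (s := (P : Set V)) (t := {x})
    hP.preconnected (induce_singleton_connected G x).preconnected hy (Set.mem_singleton x) hxy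
  rwa [Finset.coe_insert, Set.insert_eq, Set.union_comm]

/-- In a set `W` whose small subsets have large boundary, balls grow geometrically until they
contain more than half of `W`. -/
theorem exists_reachable_set {V : Type*} [DecidableEq V] (G : SimpleGraph V) (W : Finset V)
    {ε : ℝ} (hε : 0 ≤ ε)
    (hexp : ∀ D ⊆ W, D.Nonempty → 2 * D.card ≤ W.card →
      ε * D.card < ((outerBoundary G W D).card : ℝ)) {w : V} (hw : w ∈ W) (j : ℕ) :
    ∃ D ⊆ W, w ∈ D ∧ (∀ x ∈ D, ∃ P ⊆ W, (G.induce (P : Set V)).Connected ∧ w ∈ P ∧ x ∈ P ∧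
      P.card ≤ j + 1) ∧ (W.card < 2 * D.card ∨ (1 + ε) ^ j ≤ (D.card : ℝ)) := by
  induction j with
  | zero =>
    refine ⟨{w}, by simpa using hw, by simp, fun x hx => ⟨{w}, by simpa using hw, ?_, by simp,
      hx, by simp⟩, Or.inr (by simp)⟩
    rw [Finset.coe_singleton]
    exact induce_singleton_connected G w
  | succ j ih =>
    obtain ⟨D, hDW, hwD, hP, hD⟩ := ih
    have hdisj : Disjoint D (outerBoundary G W D) := by
      rw [Finset.disjoint_left]
      intro x hx hx'
      exact (mem_outerBoundary.1 hx').2.1 hx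
    have hcard := Finset.card_union_of_disjoint hdisj
    refine ⟨D ∪ outerBoundary G W D, Finset.union_subset hDW fun x hx => (mem_outerBoundary.1 hx).1,
      Finset.mem_union_left _ hwD, fun x hx => ?_, ?_⟩
    · rcases Finset.mem_union.1 hx with hx | hx
      · obtain ⟨P, h1, h2, h3, h4, h5⟩ := hP x hx
        exact ⟨P, h1, h2, h3, h4, by omega⟩
      · obtain ⟨hxW, -, y, hy, hyx⟩ := mem_outerBoundary.1 hx
        obtain ⟨P, h1, h2, h3, h4, h5⟩ := hP y hy
        refine ⟨insert x P, Finset.insert_subset hxW h1, induce_insert_connected h2 h4 hyx,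
          Finset.mem_insert_of_mem h3, Finset.mem_insert_self _ _, ?_⟩
        exact (Finset.card_insert_le _ _).trans (by omega)
    · rw [hcard]
      by_cases hbig : W.card < 2 * D.card
      · left; omega
      · right
        have h1 := hexp D hDW ⟨w, hwD⟩ (by omega)
        have h2 := hD.resolve_left hbig
        push_cast
        rw [pow_succ]
        nlinarith

theorem exists_connected_union {V : Type*} [DecidableEq V] (G : SimpleGraph V) (W : Finset V)
    {w : V} (hw : w ∈ W) (m : ℕ) (B : Finset (Finset V)) (p : Finset V → V → Prop)
    (h : ∀ b ∈ B, ∃ Q ⊆ W, (G.induce (Q : Set V)).Connected ∧ w ∈ Q ∧ Q.card ≤ m ∧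
      ∃ x ∈ Q, p b x) :
    ∃ Q ⊆ W, (G.induce (Q : Set V)).Connected ∧ w ∈ Q ∧ Q.card ≤ B.card * m + 1 ∧
      ∀ b ∈ B, ∃ x ∈ Q, p b x := by
  induction B using Finset.induction_on with
  | empty =>
    exact ⟨{w}, by simpa using hw,
      (Finset.coe_singleton w).symm ▸ induce_singleton_connected G w, by simp, by simp, by simp⟩
  | insert b B hb ih =>
    obtain ⟨Q, h1, h2, h3, h4, h5⟩ := ih fun c hc => h c (Finset.mem_insert_of_mem hc)
    obtain ⟨P, k1, k2, k3, k4, x, k5, k6⟩ := h b (Finset.mem_insert_self _ _)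
    refine ⟨Q ∪ P, Finset.union_subset h1 k1, ?_, Finset.mem_union_left _ h3, ?_, ?_⟩
    · rw [Finset.coe_union]
      exact SimpleGraph.induce_union_connected h2.preconnected k2.preconnected ⟨w, h3, k3⟩
    · rw [Finset.card_insert_of_notMem hb]
      have := Finset.card_union_le Q P
      nlinarith
    · intro c hc
      rcases Finset.mem_insert.1 hc with rfl | hc
      · exact ⟨x, Finset.mem_union_right _ k5, k6⟩
      · obtain ⟨y, hy, hp⟩ := h5 c hc
        exact ⟨y, Finset.mem_union_left _ hy, hp⟩

/-- Intermediate stage in the construction of a balanced separation of `U`: the part `X` is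
separated from `W` by `Y` together with the branch sets in `B`. -/
structure IsPartialSeparation {V : Type*} [DecidableEq V] (G : SimpleGraph V) (U : Finset V)
    (ε : ℝ) (M : ℕ) (X W Y : Finset V) (B : Finset (Finset V)) : Prop where
  X_subset : X ⊆ U
  W_subset : W ⊆ U
  disjoint : Disjoint X W
  not_adj : ∀ x ∈ X, ∀ w ∈ W, ¬ G.Adj x w
  X_card : 3 * X.card ≤ 2 * U.card
  cover : U ⊆ X ∪ W ∪ Y ∪ B.biUnion id
  Y_card : (Y.card : ℝ) ≤ ε * X.card
  model : IsCliqueModel G B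
  branch_subset : ∀ b ∈ B, b ⊆ U
  branch_disjoint : ∀ b ∈ B, Disjoint b W
  branch_card : ∀ b ∈ B, b.card ≤ M

theorem IsPartialSeparation.exists_smaller {V : Type*} [DecidableEq V] {G : SimpleGraph V} {r : ℕ}
    {H : SimpleGraph (Fin r)} (hG : ¬ HasMinor G H) {U : Finset V} {ε : ℝ} (hε : 0 ≤ ε) {t : ℕ}
    (ht : (U.card : ℝ) < (1 + ε) ^ t) {X W Y : Finset V} {B : Finset (Finset V)}
    (h : IsPartialSeparation G U ε (r * (2 * t + 2)) X W Y B) (hW : 2 * U.card < 3 * W.card) :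
    ∃ X' W' Y' B', IsPartialSeparation G U ε (r * (2 * t + 2)) X' W' Y' B' ∧
      2 * W'.card + B'.card < 2 * W.card + B.card := by
  have hBr : B.card < r := by
    by_contra! hcon
    exact hG (h.model.hasMinor hcon H)
  by_cases h1 : ∃ b ∈ B, ∀ u ∈ b, ∀ w ∈ W, ¬ G.Adj u w
  · obtain ⟨b, hb, hbW⟩ := h1
    have hXb : X ∪ b ⊆ U := Finset.union_subset h.X_subset (h.branch_subset b hb)
    have hd : Disjoint (X ∪ b) W := Finset.disjoint_union_left.2 ⟨h.disjoint, h.branch_disjoint b hb⟩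
    refine ⟨X ∪ b, W, Y, B.erase b, ⟨hXb, h.W_subset, hd, ?_, ?_, ?_, ?_, ⟨?_, ?_, ?_⟩, ?_, ?_, ?_⟩,
      ?_⟩
    · intro x hx w hw
      rcases Finset.mem_union.1 hx with hx | hx
      · exact h.not_adj x hx w hw
      · exact hbW x hx w hw
    · have := Finset.card_le_card (Finset.union_subset hXb h.W_subset)
      rw [Finset.card_union_of_disjoint hd] at this
      omega
    · intro x hx
      have := h.cover hx
      simp only [Finset.mem_union, Finset.mem_biUnion, id, Finset.mem_erase] at this ⊢
      by_cases hxb : x ∈ b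
      · tauto
      · rcases this with h' | ⟨c, hc, hxc⟩
        · tauto
        · exact Or.inr ⟨c, ⟨fun h => hxb (h ▸ hxc), hc⟩, hxc⟩
    · refine h.Y_card.trans (mul_le_mul_of_nonneg_left ?_ hε)
      exact_mod_cast Finset.card_le_card Finset.subset_union_left
    · exact fun c hc => h.model.connected c (Finset.mem_of_mem_erase hc)
    · exact fun c hc c' hc' => h.model.disjoint c (Finset.mem_of_mem_erase hc) c'
        (Finset.mem_of_mem_erase hc')
    · exact fun c hc c' hc' => h.model.adj c (Finset.mem_of_mem_erase hc) c'
        (Finset.mem_of_mem_erase hc')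
    · exact fun c hc => h.branch_subset c (Finset.mem_of_mem_erase hc)
    · exact fun c hc => h.branch_disjoint c (Finset.mem_of_mem_erase hc)
    · exact fun c hc => h.branch_card c (Finset.mem_of_mem_erase hc)
    · have := Finset.card_erase_lt_of_mem hb
      omega
  push Not at h1
  by_cases h2 : ∃ D ⊆ W, D.Nonempty ∧ 2 * D.card ≤ W.card ∧
      ((outerBoundary G W D).card : ℝ) ≤ ε * D.card
  · obtain ⟨D, hDW, hDne, hDc, hDb⟩ := h2
    have hXD : Disjoint X D := h.disjoint.mono_right hDW
    refine ⟨X ∪ D, W \ (D ∪ outerBoundary G W D), Y ∪ outerBoundary G W D, B,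
      ⟨Finset.union_subset h.X_subset (hDW.trans h.W_subset), Finset.sdiff_subset.trans h.W_subset,
        ?_, ?_, ?_, ?_, ?_, h.model, h.branch_subset,
        fun b hb => (h.branch_disjoint b hb).mono_right Finset.sdiff_subset, h.branch_card⟩, ?_⟩
    · refine Finset.disjoint_union_left.2 ⟨h.disjoint.mono_right Finset.sdiff_subset, ?_⟩
      exact Finset.disjoint_sdiff.mono_left Finset.subset_union_left
    · intro x hx w hw hxw
      obtain ⟨hwW, hw'⟩ := Finset.mem_sdiff.1 hw
      rw [Finset.mem_union, not_or] at hw'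
      rcases Finset.mem_union.1 hx with hx | hx
      · exact h.not_adj x hx w hwW hxw
      · exact hw'.2 (mem_outerBoundary.2 ⟨hwW, hw'.1, x, hx, hxw⟩)
    · have := Finset.card_le_card (Finset.union_subset h.X_subset h.W_subset)
      rw [Finset.card_union_of_disjoint h.disjoint] at this
      rw [Finset.card_union_of_disjoint hXD]
      omega
    · intro x hx
      have := h.cover hx
      simp only [Finset.mem_union, Finset.mem_sdiff] at this ⊢
      tauto
    · rw [Finset.card_union_of_disjoint hXD]
      have h3 : ((Y ∪ outerBoundary G W D).card : ℝ) ≤ Y.card + (outerBoundary G W D).card := by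
        exact_mod_cast Finset.card_union_le _ _
      have := h.Y_card
      push_cast
      linarith
    · have : (W \ (D ∪ outerBoundary G W D)).card < W.card := by
        apply Finset.card_lt_card
        rw [Finset.ssubset_iff_of_subset Finset.sdiff_subset]
        obtain ⟨x, hx⟩ := hDne
        exact ⟨x, hDW hx, by simp [hx]⟩
      omega
  push Not at h2
  have hreach : ∀ w ∈ W, ∃ D ⊆ W, W.card < 2 * D.card ∧ ∀ x ∈ D, ∃ P ⊆ W,
      (G.induce (P : Set V)).Connected ∧ w ∈ P ∧ x ∈ P ∧ P.card ≤ t + 1 := by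
    intro w hw
    obtain ⟨D, hDW, -, hP, hD⟩ := exists_reachable_set G W hε h2 hw t
    refine ⟨D, hDW, hD.resolve_right fun hD' => ?_, hP⟩
    have : (D.card : ℝ) ≤ U.card := by exact_mod_cast Finset.card_le_card (hDW.trans h.W_subset)
    linarith
  obtain ⟨w, hw⟩ : W.Nonempty := by
    rw [← Finset.card_pos]
    omega
  obtain ⟨D, hDW, hDc, hD⟩ := hreach w hw
  obtain ⟨Q, hQW, hQ, hwQ, hQc, hQB⟩ := exists_connected_union G W hw (2 * t + 2) B
    (fun b x => ∃ u ∈ b, G.Adj u x) (by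
      intro b hb
      obtain ⟨u, hu, x, hx, hux⟩ := h1 b hb
      obtain ⟨E, hEW, hEc, hE⟩ := hreach x hx
      obtain ⟨z, hz⟩ : (D ∩ E).Nonempty := by
        rw [← Finset.card_pos]
        have h3 := Finset.card_union_add_card_inter D E
        have h4 := Finset.card_le_card (Finset.union_subset hDW hEW)
        omega
      rw [Finset.mem_inter] at hz
      obtain ⟨P, h1, h2, h3, h4, h5⟩ := hD z hz.1
      obtain ⟨P', k1, k2, k3, k4, k5⟩ := hE z hz.2
      refine ⟨P ∪ P', Finset.union_subset h1 k1, ?_, Finset.mem_union_left _ h3, ?_, x,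
        Finset.mem_union_right _ k3, u, hu, hux⟩
      · rw [Finset.coe_union]
        exact SimpleGraph.induce_union_connected h2.preconnected k2.preconnected ⟨z, h4, k4⟩
      · have := Finset.card_union_le P P'
        omega)
  have hdis : ∀ b ∈ B, Disjoint b Q := fun b hb => (h.branch_disjoint b hb).mono_right hQW
  have hQB' : Q ∉ B := fun hQ' =>
    Finset.disjoint_left.1 (h.branch_disjoint Q hQ') hwQ (hQW hwQ)
  refine ⟨X, W \ Q, Y, insert Q B, ⟨h.X_subset, Finset.sdiff_subset.trans h.W_subset,
    h.disjoint.mono_right Finset.sdiff_subset,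
    fun x hx v hv => h.not_adj x hx v (Finset.sdiff_subset hv), h.X_card, ?_, h.Y_card,
    ⟨?_, ?_, ?_⟩, ?_, ?_, ?_⟩, ?_⟩
  · intro x hx
    have := h.cover hx
    simp only [Finset.mem_union, Finset.mem_sdiff, Finset.biUnion_insert, id] at this ⊢
    tauto
  · intro b hb
    rcases Finset.mem_insert.1 hb with rfl | hb
    · exact hQ
    · exact h.model.connected b hb
  · intro b hb c hc hbc
    rcases Finset.mem_insert.1 hb with rfl | hb' <;> rcases Finset.mem_insert.1 hc with rfl | hc'
    · exact absurd rfl hbc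
    · exact (hdis c hc').symm
    · exact hdis b hb'
    · exact h.model.disjoint b hb' c hc' hbc
  · intro b hb c hc hbc
    rcases Finset.mem_insert.1 hb with rfl | hb' <;> rcases Finset.mem_insert.1 hc with rfl | hc'
    · exact absurd rfl hbc
    · obtain ⟨x, hx, u, hu, hux⟩ := hQB c hc'
      exact ⟨x, hx, u, hu, hux.symm⟩
    · obtain ⟨x, hx, u, hu, hux⟩ := hQB b hb'
      exact ⟨u, hu, x, hx, hux⟩
    · exact h.model.adj b hb' c hc' hbc
  · intro b hb
    rcases Finset.mem_insert.1 hb with rfl | hb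
    · exact hQW.trans h.W_subset
    · exact h.branch_subset b hb
  · intro b hb
    rcases Finset.mem_insert.1 hb with rfl | hb
    · exact Finset.disjoint_sdiff
    · exact (h.branch_disjoint b hb).mono_right Finset.sdiff_subset
  · intro b hb
    rcases Finset.mem_insert.1 hb with rfl | hb
    · nlinarith
    · exact h.branch_card b hb
  · rw [Finset.card_insert_of_notMem hQB']
    have : (W \ Q).card < W.card := by
      apply Finset.card_lt_card
      rw [Finset.ssubset_iff_of_subset Finset.sdiff_subset]
      exact ⟨w, hw, by simp [hwQ]⟩
    omega

/-- A balanced separation of any vertex set in a minor-free graph, in the style of Plotkin, Rao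
and Smith. -/
theorem exists_balanced_separation {V : Type*} [DecidableEq V] {G : SimpleGraph V} {r : ℕ}
    {H : SimpleGraph (Fin r)} (hG : ¬ HasMinor G H) (U : Finset V) {ε : ℝ} (hε : 0 ≤ ε) {t : ℕ}
    (ht : (U.card : ℝ) < (1 + ε) ^ t) :
    ∃ X ⊆ U, ∃ W ⊆ U, Disjoint X W ∧ (∀ x ∈ X, ∀ w ∈ W, ¬ G.Adj x w) ∧
      3 * X.card ≤ 2 * U.card ∧ 3 * W.card ≤ 2 * U.card ∧
      ((U \ (X ∪ W)).card : ℝ) ≤ ε * U.card + r * (r * (2 * t + 2)) := by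
  have key : ∀ (m : ℕ) (X W Y : Finset V) (B : Finset (Finset V)),
      IsPartialSeparation G U ε (r * (2 * t + 2)) X W Y B → 2 * W.card + B.card ≤ m →
      ∃ X W Y B, IsPartialSeparation G U ε (r * (2 * t + 2)) X W Y B ∧
        3 * W.card ≤ 2 * U.card := by
    intro m
    induction m with
    | zero => exact fun X W Y B h hm => ⟨X, W, Y, B, h, by omega⟩
    | succ m ih =>
      intro X W Y B h hm
      by_cases hW : 3 * W.card ≤ 2 * U.card
      · exact ⟨X, W, Y, B, h, hW⟩
      · obtain ⟨X', W', Y', B', h', hlt⟩ := h.exists_smaller hG hε ht (by omega)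
        exact ih X' W' Y' B' h' (by omega)
  obtain ⟨X, W, Y, B, h, hW⟩ := key _ ∅ U ∅ ∅
    ⟨by simp, by simp, by simp, by simp, by simp, by simp, by simp,
      ⟨by simp, by simp, by simp⟩, by simp, by simp, by simp⟩ le_rfl
  refine ⟨X, h.X_subset, W, h.W_subset, h.disjoint, h.not_adj, h.X_card, hW, ?_⟩
  have hBr : B.card < r := by
    by_contra! hcon
    exact hG (h.model.hasMinor hcon H)
  have h1 : (U \ (X ∪ W)).card ≤ Y.card + B.card * (r * (2 * t + 2)) := by
    have hsub : U \ (X ∪ W) ⊆ Y ∪ B.biUnion id := by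
      intro x hx
      have h2 := h.cover (Finset.mem_sdiff.1 hx).1
      have h3 := (Finset.mem_sdiff.1 hx).2
      simp only [Finset.mem_union] at h2 h3 ⊢
      tauto
    refine (Finset.card_le_card hsub).trans ((Finset.card_union_le _ _).trans ?_)
    gcongr
    exact Finset.card_biUnion_le_card_mul _ _ _ h.branch_card
  have h2 : B.card * (r * (2 * t + 2)) ≤ r * (r * (2 * t + 2)) := by gcongr
  have h3 : ((U \ (X ∪ W)).card : ℝ) ≤ Y.card + r * (r * (2 * t + 2)) := by
    exact_mod_cast h1.trans (Nat.add_le_add_left h2 _)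
  have h4 : ε * X.card ≤ ε * U.card := by
    gcongr
    exact h.X_subset
  linarith [h.Y_card]

theorem lazyStep_nonneg {V : Type*} [Fintype V] [DecidableEq V] (G : SimpleGraph V)
    [DecidableRel G.Adj] {d : ℕ} (hdeg : ∀ v, G.degree v ≤ d) (u v : V) :
    0 ≤ lazyStep G d u v := by
  simp only [lazyStep, Matrix.of_apply]
  split_ifs
  · positivity
  · rw [sub_nonneg]
    have : (G.degree u : ℝ) ≤ d := by exact_mod_cast hdeg u
    exact div_le_one_of_le₀ (by linarith [Nat.cast_nonneg (α := ℝ) d]) (by positivity)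
  · exact le_rfl

theorem lazyStep_comm {V : Type*} [Fintype V] [DecidableEq V] (G : SimpleGraph V)
    [DecidableRel G.Adj] (d : ℕ) (u v : V) : lazyStep G d u v = lazyStep G d v u := by
  by_cases h : u = v
  · rw [h]
  · simp [lazyStep, G.adj_comm u v, h, Ne.symm h]

theorem sum_lazyStep {V : Type*} [Fintype V] [DecidableEq V] (G : SimpleGraph V)
    [DecidableRel G.Adj] (d : ℕ) (u : V) : ∑ v, lazyStep G d u v = 1 := by
  have h : ∀ v, lazyStep G d u v = (if G.Adj u v then 1 / (2 * d : ℝ) else 0) +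
      (if u = v then 1 - (G.degree u : ℝ) / (2 * d) else 0) := by
    intro v
    by_cases huv : u = v
    · subst huv
      simp [lazyStep]
    · simp [lazyStep, huv]
  simp_rw [h, Finset.sum_add_distrib]
  rw [← Finset.sum_filter, ← SimpleGraph.neighborFinset_eq_filter, Finset.sum_const,
    SimpleGraph.card_neighborFinset_eq_degree]
  simp
  ring

theorem lazyStep_pow_nonneg {V : Type*} [Fintype V] [DecidableEq V] (G : SimpleGraph V)
    [DecidableRel G.Adj] {d : ℕ} (hdeg : ∀ v, G.degree v ≤ d) (t : ℕ) (u v : V) :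
    0 ≤ (lazyStep G d ^ t) u v := by
  induction t generalizing u with
  | zero => rw [pow_zero, Matrix.one_apply]; split_ifs <;> norm_num
  | succ t ih =>
    rw [pow_succ', Matrix.mul_apply]
    exact Finset.sum_nonneg fun w _ => mul_nonneg (lazyStep_nonneg G hdeg u w) (ih w)

/-- The probability that the first `t` steps of the lazy walk, including its start, avoid `R`. -/
def avoidProb {V : Type*} [Fintype V] [DecidableEq V] (G : SimpleGraph V) [DecidableRel G.Adj]
    (d : ℕ) (R : Finset V) : ℕ → V → ℝ
  | 0 => fun v => if v ∈ R then 0 else 1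
  | t + 1 => fun v => if v ∈ R then 0 else ∑ w, lazyStep G d v w * avoidProb G d R t w

theorem avoidProb_mem_Icc {V : Type*} [Fintype V] [DecidableEq V] (G : SimpleGraph V)
    [DecidableRel G.Adj] {d : ℕ} (hdeg : ∀ v, G.degree v ≤ d) (R : Finset V) (t : ℕ) (v : V) :
    0 ≤ avoidProb G d R t v ∧ avoidProb G d R t v ≤ 1 := by
  induction t generalizing v with
  | zero => unfold avoidProb; split_ifs <;> norm_num
  | succ t ih =>
    unfold avoidProb
    split_ifs
    · norm_num
    · refine ⟨Finset.sum_nonneg fun w _ => mul_nonneg (lazyStep_nonneg G hdeg v w) (ih w).1, ?_⟩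
      rw [← sum_lazyStep G d v]
      exact Finset.sum_le_sum fun w _ =>
        mul_le_of_le_one_right (lazyStep_nonneg G hdeg v w) (ih w).2

theorem avoidProb_eq_zero {V : Type*} [Fintype V] [DecidableEq V] (G : SimpleGraph V)
    [DecidableRel G.Adj] (d : ℕ) {R : Finset V} (t : ℕ) {v : V} (hv : v ∈ R) :
    avoidProb G d R t v = 0 := by
  cases t <;> simp [avoidProb, hv]

theorem sum_avoidProb_ge {V : Type*} [Fintype V] [DecidableEq V] (G : SimpleGraph V)
    [DecidableRel G.Adj] {d : ℕ} (hdeg : ∀ v, G.degree v ≤ d) (R : Finset V) (t : ℕ) :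
    (Fintype.card V : ℝ) - (t + 1) * R.card ≤ ∑ v, avoidProb G d R t v := by
  have hR : ∑ v, (if v ∈ R then (1 : ℝ) else 0) = R.card := by simp
  induction t with
  | zero =>
    have h : ∀ v, avoidProb G d R 0 v = 1 - if v ∈ R then (1 : ℝ) else 0 := by
      intro v
      unfold avoidProb
      split_ifs <;> norm_num
    simp_rw [h, Finset.sum_sub_distrib, hR]
    simp
  | succ t ih =>
    have h : ∀ v, (∑ w, lazyStep G d v w * avoidProb G d R t w) - (if v ∈ R then (1 : ℝ) else 0)
        ≤ avoidProb G d R (t + 1) v := by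
      intro v
      simp only [avoidProb]
      split_ifs
      · rw [sub_nonpos, ← sum_lazyStep G d v]
        exact Finset.sum_le_sum fun w _ => mul_le_of_le_one_right (lazyStep_nonneg G hdeg v w)
          (avoidProb_mem_Icc G hdeg R t w).2
      · simp
    have h2 := Finset.sum_le_sum fun v (_ : v ∈ Finset.univ) => h v
    rw [Finset.sum_sub_distrib, hR, Finset.sum_comm] at h2
    have h3 : ∀ w, ∑ v, lazyStep G d v w * avoidProb G d R t w = avoidProb G d R t w := by
      intro w
      simp_rw [← Finset.sum_mul, lazyStep_comm G d _ w, sum_lazyStep, one_mul]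
    simp_rw [h3] at h2
    push_cast
    linarith

theorem avoidProb_le_sum {V : Type*} [Fintype V] [DecidableEq V] (G : SimpleGraph V)
    [DecidableRel G.Adj] {d : ℕ} (hdeg : ∀ v, G.degree v ≤ d) {R : Finset V}
    {piece : V → Finset V} (hmem : ∀ v ∉ R, v ∈ piece v)
    (hadj : ∀ u ∉ R, ∀ v ∉ R, G.Adj u v → piece u = piece v) (t : ℕ) (v : V) :
    avoidProb G d R t v ≤ ∑ u ∈ piece v, walkDist G d t v u := by
  have hnn := lazyStep_pow_nonneg G hdeg
  induction t generalizing v with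
  | zero =>
    by_cases hv : v ∈ R
    · rw [avoidProb_eq_zero G d 0 hv]
      exact Finset.sum_nonneg fun u _ => hnn 0 v u
    · simp [avoidProb, hv, walkDist, Matrix.one_apply, hmem v hv]
  | succ t ih =>
    by_cases hv : v ∈ R
    · rw [avoidProb_eq_zero G d _ hv]
      exact Finset.sum_nonneg fun u _ => hnn _ v u
    · simp only [avoidProb, hv, if_false, walkDist, pow_succ', Matrix.mul_apply]
      rw [Finset.sum_comm]
      simp_rw [← Finset.mul_sum]
      refine Finset.sum_le_sum fun w _ => ?_
      by_cases hw : w ∈ R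
      · rw [avoidProb_eq_zero G d _ hw, mul_zero]
        exact mul_nonneg (lazyStep_nonneg G hdeg v w) (Finset.sum_nonneg fun u _ => hnn _ w u)
      by_cases hvw : v = w ∨ G.Adj v w
      · have hp : piece v = piece w := by
          rcases hvw with rfl | hvw
          · rfl
          · exact hadj v hv w hw hvw
        rw [hp]
        exact mul_le_mul_of_nonneg_left (ih w) (lazyStep_nonneg G hdeg v w)
      · rw [not_or] at hvw
        simp [lazyStep, hvw.1, hvw.2]

theorem le_clipNormSq_of_mass {W : Type*} [Fintype W] {x : W → ℝ} (hx : ∀ v, 0 ≤ x v) {ξ m : ℝ}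
    (hξ : 0 ≤ ξ) (C : Finset W) (hm : ξ ≤ m) (hC : m ≤ ∑ v ∈ C, x v) {N : ℝ} (hN : 0 < N)
    (hCN : (C.card : ℝ) ≤ N) : (m - ξ) ^ 2 / N ≤ clipNormSq x ξ := by
  refine le_csInf ⟨_, x, fun v => ⟨hx v, le_rfl⟩, by simpa using hξ, rfl⟩ ?_
  rintro _ ⟨y, hy, hxy, rfl⟩
  have h1 : ∑ v ∈ C, (x v - y v) ≤ ξ :=
    calc ∑ v ∈ C, (x v - y v) ≤ ∑ v ∈ C, |x v - y v| := Finset.sum_le_sum fun v _ => le_abs_self _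
      _ ≤ ∑ v, |x v - y v| :=
        Finset.sum_le_sum_of_subset_of_nonneg (Finset.subset_univ _) fun _ _ _ => abs_nonneg _
      _ ≤ ξ := hxy
  rw [Finset.sum_sub_distrib] at h1
  have h2 : (∑ v ∈ C, y v) ^ 2 ≤ C.card * ∑ v ∈ C, y v ^ 2 := sq_sum_le_card_mul_sum_sq
  have h3 : ∑ v ∈ C, y v ^ 2 ≤ ∑ v, y v ^ 2 :=
    Finset.sum_le_sum_of_subset_of_nonneg (Finset.subset_univ _) fun _ _ _ => sq_nonneg _
  rw [div_le_iff₀ hN]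
  calc (m - ξ) ^ 2 ≤ (∑ v ∈ C, y v) ^ 2 := by
        apply pow_le_pow_left₀ <;> linarith
    _ ≤ C.card * ∑ v ∈ C, y v ^ 2 := h2
    _ ≤ N * ∑ v, y v ^ 2 := by gcongr
    _ = _ := mul_comm _ _

theorem separator_potential_le {r κ q x y : ℝ} (hr : 0 < r) (hκ : 300 * r ≤ κ) (hq : κ ≤ q)
    (hx : 0 ≤ x) (hy : 0 ≤ y) (hxq : 3 * x ^ 3 ≤ 2 * q ^ 3) (hyq : 3 * y ^ 3 ≤ 2 * q ^ 3)
    (hxy : x ^ 3 + y ^ 3 ≤ q ^ 3) (hs : q ^ 3 ≤ x ^ 3 + y ^ 3 + 15 * r * q ^ 2) :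
    max 0 (608 * r / κ * x ^ 3 - 375 / 2 * r * x ^ 2) +
      max 0 (608 * r / κ * y ^ 3 - 375 / 2 * r * y ^ 2) + 15 * r * q ^ 2 ≤
      max 0 (608 * r / κ * q ^ 3 - 375 / 2 * r * q ^ 2) := by
  have hκ0 : 0 < κ := by linarith
  have hq0 : 0 < q := by linarith
  set a := 608 * r / κ with ha
  have ha0 : 0 < a := by positivity
  have haq : 608 * r ≤ a * q := by
    rw [ha, div_mul_eq_mul_div, le_div_iff₀ hκ0]
    gcongr
  have haq3 : 608 * r * q ^ 2 ≤ a * q ^ 3 := by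
    have := mul_le_mul_of_nonneg_right haq (sq_nonneg q)
    nlinarith
  have hbound : ∀ z : ℝ, 0 ≤ z → 3 * z ^ 3 ≤ 2 * q ^ 3 → z ≤ 437 / 500 * q := by
    intro z hz hzq
    refine le_of_pow_le_pow_left₀ (n := 3) (by norm_num) (by positivity) ?_
    rw [mul_pow]
    nlinarith [pow_pos hq0 3]
  have hsq : ∀ z : ℝ, 0 ≤ z → 3 * z ^ 3 ≤ 2 * q ^ 3 → z ^ 3 ≤ 437 / 500 * q * z ^ 2 := by
    intro z hz hzq
    have := mul_le_mul_of_nonneg_right (hbound z hz hzq) (sq_nonneg z)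
    nlinarith
  have hsqsum : 27 / 25 * q ^ 2 ≤ x ^ 2 + y ^ 2 := by
    have h1 := hsq x hx hxq
    have h2 := hsq y hy hyq
    have h3 : 15 * r * q ^ 2 ≤ 1 / 20 * q * q ^ 2 :=
      mul_le_mul_of_nonneg_right (by linarith) (sq_nonneg q)
    have h4 : 19 / 20 * q ^ 2 * q ≤ 437 / 500 * (x ^ 2 + y ^ 2) * q := by nlinarith
    have h5 := le_of_mul_le_mul_right h4 hq0
    nlinarith [sq_nonneg q]
  have hax : a * (3 * x ^ 3) ≤ a * (2 * q ^ 3) := by gcongr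
  have hay : a * (3 * y ^ 3) ≤ a * (2 * q ^ 3) := by gcongr
  have haxy : a * (x ^ 3 + y ^ 3) ≤ a * q ^ 3 := by gcongr
  have hrx : 0 ≤ r * x ^ 2 := by positivity
  have hry : 0 ≤ r * y ^ 2 := by positivity
  have hrq : 0 ≤ r * q ^ 2 := by positivity
  have hrs : r * (27 / 25 * q ^ 2) ≤ r * (x ^ 2 + y ^ 2) := by gcongr
  refine le_max_of_le_right ?_
  rcases max_choice 0 (a * x ^ 3 - 375 / 2 * r * x ^ 2) with h1 | h1 <;>
  rcases max_choice 0 (a * y ^ 3 - 375 / 2 * r * y ^ 2) with h2 | h2 <;>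
  rw [h1, h2] <;> nlinarith

/-- A bound of order `r q²` on the separator when `U` has `q³` elements. -/
theorem exists_balanced_separation_of_cube {V : Type*} [DecidableEq V] {G : SimpleGraph V} {r : ℕ}
    {H : SimpleGraph (Fin r)} (hG : ¬ HasMinor G H) (hr : 1 ≤ r) (U : Finset V) {q : ℝ}
    (hq : (r : ℝ) ≤ q) (hU : q ^ 3 = U.card) :
    ∃ X ⊆ U, ∃ W ⊆ U, Disjoint X W ∧ (∀ x ∈ X, ∀ w ∈ W, ¬ G.Adj x w) ∧
      3 * X.card ≤ 2 * U.card ∧ 3 * W.card ≤ 2 * U.card ∧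
      ((U \ (X ∪ W)).card : ℝ) ≤ 15 * r * q ^ 2 := by
  have hr1 : (1 : ℝ) ≤ r := by exact_mod_cast hr
  have hr0 : (0 : ℝ) < r := by linarith
  have hq0 : 0 < q := by linarith
  set s := ⌈q ^ 2 / r⌉₊
  have hs1 : q ^ 2 / r ≤ s := Nat.le_ceil _
  have hs2 : (s : ℝ) < q ^ 2 / r + 1 := Nat.ceil_lt_add_one (by positivity)
  have ht : (U.card : ℝ) < (1 + r / q) ^ (s * 3) := by
    rw [← hU, pow_mul]
    refine pow_lt_pow_left₀ ?_ hq0.le (by norm_num)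
    have h1 := one_add_mul_le_pow (a := (r : ℝ) / q) (by linarith [div_pos hr0 hq0]) s
    have h2 : q ≤ s * (r / q) := by
      calc q = q ^ 2 / r * (r / q) := by field_simp
        _ ≤ _ := by gcongr
    linarith
  obtain ⟨X, hX, W, hW, h1, h2, h3, h4, h5⟩ :=
    exists_balanced_separation hG U (ε := r / q) (by positivity) ht
  refine ⟨X, hX, W, hW, h1, h2, h3, h4, h5.trans ?_⟩
  rw [← hU]
  have e1 : r / q * q ^ 3 = r * q ^ 2 := by field_simp
  have e2 : (r : ℝ) * s ≤ q ^ 2 + r := by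
    have := mul_lt_mul_of_pos_left hs2 hr0
    have e : (r : ℝ) * (q ^ 2 / r + 1) = q ^ 2 + r := by field_simp
    linarith
  have e3 : (r : ℝ) ≤ q ^ 2 := by nlinarith
  rw [e1]
  push_cast
  have e4 : (r : ℝ) * (r * s) ≤ r * (q ^ 2 + r) := by gcongr
  have e5 : (r : ℝ) * r ≤ r * q ^ 2 := by gcongr
  nlinarith

/-- Deleting few vertices from a minor-free graph leaves pieces of bounded size. -/
theorem exists_piece_decomposition {V : Type*} [DecidableEq V] {G : SimpleGraph V} {r : ℕ}
    {H : SimpleGraph (Fin r)} (hG : ¬ HasMinor G H) (hr : 1 ≤ r) {κ : ℝ} (hκ : 300 * r ≤ κ)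
    (U : Finset V) (q : ℝ) (hq : 0 ≤ q) (hU : q ^ 3 = U.card) :
    ∃ (R : Finset V) (piece : V → Finset V),
      (R.card : ℝ) ≤ max 0 (608 * r / κ * q ^ 3 - 375 / 2 * r * q ^ 2) ∧
      (∀ v ∈ U, v ∉ R → v ∈ piece v ∧ ((piece v).card : ℝ) ≤ κ ^ 3) ∧
      ∀ u ∈ U, u ∉ R → ∀ v ∈ U, v ∉ R → G.Adj u v → piece u = piece v := by
  have hr1 : (1 : ℝ) ≤ r := by exact_mod_cast hr
  induction hn : U.card using Nat.strong_induction_on generalizing U q with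
  | _ n ih =>
    by_cases hqκ : q ≤ κ
    · refine ⟨∅, fun _ => U, by simp, fun v hv _ => ⟨hv, ?_⟩, fun _ _ _ _ _ _ _ => rfl⟩
      rw [← hU]
      gcongr
    push Not at hqκ
    obtain ⟨X, hX, W, hW, hd, hna, hXc, hWc, hS⟩ :=
      exists_balanced_separation_of_cube hG hr U (by linarith) hU
    have hpos : 0 < U.card := by
      have : 0 < q ^ 3 := pow_pos (by linarith) 3
      rw [hU] at this
      exact_mod_cast this
    have hroot : ∀ m : ℕ, ∃ z : ℝ, 0 ≤ z ∧ z ^ 3 = m := fun m =>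
      ⟨(m : ℝ) ^ ((3 : ℕ) : ℝ)⁻¹, by positivity,
        Real.rpow_inv_natCast_pow (by positivity) (by norm_num)⟩
    obtain ⟨x, hx, hx3⟩ := hroot X.card
    obtain ⟨y, hy, hy3⟩ := hroot W.card
    obtain ⟨R₁, p₁, hR₁, hp₁, hadj₁⟩ := ih X.card (by omega) X x hx hx3 rfl
    obtain ⟨R₂, p₂, hR₂, hp₂, hadj₂⟩ := ih W.card (by omega) W y hy hy3 rfl
    have hcard : (U \ (X ∪ W)).card + (X.card + W.card) = U.card := by
      rw [← Finset.card_union_of_disjoint hd]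
      exact Finset.card_sdiff_add_card_eq_card (Finset.union_subset hX hW)
    have hcardR : ((U \ (X ∪ W)).card : ℝ) + (X.card + W.card) = U.card := by exact_mod_cast hcard
    have hpot := separator_potential_le (r := r) (by linarith) hκ hqκ.le hx hy
      (by rw [hx3, hU]; exact_mod_cast hXc) (by rw [hy3, hU]; exact_mod_cast hWc)
      (by rw [hx3, hy3, hU]; linarith [Nat.cast_nonneg (α := ℝ) (U \ (X ∪ W)).card])
      (by rw [hx3, hy3, hU]; linarith)
    have hXW : ∀ {v}, v ∈ U → v ∉ U \ (X ∪ W) → v ∉ X → v ∈ W := by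
      intro v hv hv' hvX
      simp only [Finset.mem_sdiff, Finset.mem_union] at hv'
      tauto
    refine ⟨U \ (X ∪ W) ∪ (R₁ ∪ R₂), fun v => if v ∈ X then p₁ v else p₂ v, ?_, ?_, ?_⟩
    · have h1 : ((U \ (X ∪ W) ∪ (R₁ ∪ R₂)).card : ℝ) ≤
          (U \ (X ∪ W)).card + (R₁.card + R₂.card) := by
        exact_mod_cast (Finset.card_union_le _ _).trans
          (Nat.add_le_add_left (Finset.card_union_le _ _) _)
      linarith
    · intro v hv hvR
      simp only [Finset.mem_union (s := U \ (X ∪ W)), Finset.mem_union (s := R₁), not_or] at hvR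
      dsimp only
      split_ifs with hvX
      · exact hp₁ v hvX hvR.2.1
      · exact hp₂ v (hXW hv hvR.1 hvX) hvR.2.2
    · intro u hu huR v hv hvR huv
      simp only [Finset.mem_union (s := U \ (X ∪ W)), Finset.mem_union (s := R₁), not_or] at huR hvR
      dsimp only
      split_ifs with huX hvX hvX
      · exact hadj₁ u huX huR.2.1 v hvX hvR.2.1 huv
      · exact absurd huv (hna u huX v (hXW hv hvR.1 hvX))
      · exact absurd huv.symm (hna v hvX u (hXW hu huR.1 huX))
      · exact hadj₂ u (hXW hu huR.1 huX) huR.2.2 v (hXW hv hvR.1 hvX) hvR.2.2 huv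

/-- In an `H`-minor-free graph of maximum degree at most `d`, for every
`ℓ ≥ α r³` at least `(1 - 1/ℓ) n` vertices `v` satisfy `‖clip(p_v^ℓ, 3/8)‖₂² ≥ ℓ⁻⁷`. -/
theorem clip_norm_large_in_minor_free :
    ∃ α : ℝ, 0 < α ∧
      ∀ (r n d : ℕ) (H : SimpleGraph (Fin r))
        (V : Type) [Fintype V] [DecidableEq V]
        (G : SimpleGraph V) [DecidableRel G.Adj],
        Fintype.card V = n → 1 ≤ d → (∀ v, G.degree v ≤ d) →
        ¬ HasMinor G H →
        ∀ ℓ : ℕ, α * (r : ℝ) ^ 3 ≤ (ℓ : ℝ) →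
          (1 - 1 / (ℓ : ℝ)) * (n : ℝ) ≤
            ({v : V | 1 / (ℓ : ℝ) ^ 7 ≤ clipNormSq (walkDist G d ℓ v) (3 / 8)}.ncard : ℝ) := by
  refine ⟨4 * 19456 ^ 3, by norm_num, ?_⟩
  intro r n d H V _ _ G _ hn hd hdeg hG ℓ hℓ
  have hr : 1 ≤ r := by
    by_contra! hr0
    obtain rfl : r = 0 := by omega
    exact hG ⟨fun i => i.elim0, fun i => i.elim0, fun i => i.elim0, fun i => i.elim0,
      fun i => i.elim0⟩
  have hr1 : (1 : ℝ) ≤ r := by exact_mod_cast hr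
  have hr3 : (1 : ℝ) ≤ (r : ℝ) ^ 3 := one_le_pow₀ hr1
  have hℓ1 : (1 : ℝ) ≤ ℓ := by linarith
  set L : ℝ := (ℓ : ℝ) * (ℓ + 1) with hL
  have hL1 : 1 ≤ L := by nlinarith
  have hL2 : L ≤ 2 * (ℓ : ℝ) ^ 2 := by nlinarith
  set κ : ℝ := 9728 * r * L with hκ
  have hrL : (r : ℝ) * 1 ≤ r * L := by gcongr
  have hκr : 300 * (r : ℝ) ≤ κ := by rw [hκ]; linarith
  have hκ0 : 0 < κ := by linarith
  have hκL : κ ≤ 9728 * r * (2 * (ℓ : ℝ) ^ 2) := by rw [hκ]; gcongr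
  have hκ3 : 4 * κ ^ 3 ≤ (ℓ : ℝ) ^ 7 :=
    calc 4 * κ ^ 3 ≤ 4 * (9728 * r * (2 * (ℓ : ℝ) ^ 2)) ^ 3 := by gcongr
      _ = 4 * 19456 ^ 3 * (r : ℝ) ^ 3 * (ℓ : ℝ) ^ 6 := by ring
      _ ≤ ℓ * (ℓ : ℝ) ^ 6 := by gcongr
      _ = (ℓ : ℝ) ^ 7 := by ring
  obtain ⟨R, piece, hR, hp, hadj⟩ := exists_piece_decomposition hG hr hκr (Finset.univ : Finset V)
    ((n : ℝ) ^ ((3 : ℕ) : ℝ)⁻¹) (by positivity)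
    (by rw [Real.rpow_inv_natCast_pow (by positivity) (by norm_num), Finset.card_univ, hn])
  have hRn : 16 * L * R.card ≤ n := by
    rw [Real.rpow_inv_natCast_pow (by positivity) (by norm_num)] at hR
    have h1 : (R.card : ℝ) ≤ 608 * r / κ * n :=
      hR.trans (max_le (by positivity) (sub_le_self _ (by positivity)))
    have h2 : 16 * L * (608 * r / κ * n) = n := by
      rw [hκ]
      field_simp
      norm_num
    calc 16 * L * R.card ≤ 16 * L * (608 * r / κ * n) := by gcongr
      _ = n := h2
  have hgood : ∀ v, 15 / 16 ≤ avoidProb G d R ℓ v →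
      1 / (ℓ : ℝ) ^ 7 ≤ clipNormSq (walkDist G d ℓ v) (3 / 8) := by
    intro v hv
    have hvR : v ∉ R := by
      intro h
      rw [avoidProb_eq_zero G d ℓ h] at hv
      norm_num at hv
    have h1 := avoidProb_le_sum G hdeg (fun v h => (hp v (Finset.mem_univ v) h).1)
      (fun u hu v hv => hadj u (Finset.mem_univ u) hu v (Finset.mem_univ v) hv) ℓ v
    refine le_trans ?_ (le_clipNormSq_of_mass (fun u => lazyStep_pow_nonneg G hdeg ℓ v u)
      (by norm_num) (piece v) (m := 15 / 16) (by norm_num) (hv.trans h1) (pow_pos hκ0 3)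
      (hp v (Finset.mem_univ v) hvR).2)
    rw [div_le_div_iff₀ (by positivity) (by positivity)]
    nlinarith [pow_pos hκ0 3]
  set good : Finset V := Finset.univ.filter fun v => 15 / 16 ≤ avoidProb G d R ℓ v with hgooddef
  have hsub : (good.card : ℝ) ≤
      ({v : V | 1 / (ℓ : ℝ) ^ 7 ≤ clipNormSq (walkDist G d ℓ v) (3 / 8)}.ncard : ℝ) := by
    rw [← Set.ncard_coe_finset]
    exact_mod_cast Set.ncard_le_ncard (fun v hv => hgood v (Finset.mem_filter.1 hv).2)
      (Set.toFinite _)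
  refine le_trans ?_ hsub
  have hsum := sum_avoidProb_ge G hdeg R ℓ
  have hpt : ∀ v, avoidProb G d R ℓ v ≤ 15 / 16 + 1 / 16 * if v ∈ good then (1 : ℝ) else 0 := by
    intro v
    split_ifs with h
    · linarith [(avoidProb_mem_Icc G hdeg R ℓ v).2]
    · have : ¬ 15 / 16 ≤ avoidProb G d R ℓ v := by simpa [hgooddef] using h
      linarith
  have hsum2 := Finset.sum_le_sum fun v (_ : v ∈ Finset.univ) => hpt v
  rw [Finset.sum_add_distrib, ← Finset.mul_sum] at hsum2
  simp only [Finset.sum_const, Finset.card_univ, hn, nsmul_eq_mul, Finset.sum_ite_mem,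
    Finset.univ_inter, mul_one] at hsum2
  rw [hn] at hsum
  have hfin : 16 * ((ℓ : ℝ) + 1) * R.card ≤ 1 / ℓ * n := by
    rw [one_div, ← div_eq_inv_mul, le_div_iff₀ (by linarith)]
    calc 16 * ((ℓ : ℝ) + 1) * R.card * ℓ = 16 * L * R.card := by rw [hL]; ring
      _ ≤ n := hRn
  linarith
end
end

section
/- There is an absolute constant α > 0 such that the following holds. Let H be a graph on r vertices and let G be an H-minor-free simple graph on n vertices with maximum degree at most d. Then for every positive integer k there exists a set of at most α·n·r^{3/2}/k^{1/2} vertices whose removal leaves a graph in which every connected component has at most k vertices. -/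
open scoped Classical

noncomputable section

/-- A finite vertex set is `ConnectedOn` if it is nonempty and has no proper nonempty subset
closed under adjacency. -/
def ConnectedOn {V : Type*} (G : SimpleGraph V) (K : Finset V) : Prop :=
  K.Nonempty ∧ ∀ S ⊆ K, S.Nonempty → (∀ u ∈ S, ∀ v ∈ K, G.Adj u v → v ∈ S) → K ⊆ S

namespace ConnectedOn

variable {V : Type*} {G : SimpleGraph V}

theorem induce_connected {K : Finset V} (hK : ConnectedOn G K) :
    (G.induce (K : Set V)).Connected := by
  obtain ⟨⟨a, ha⟩, h⟩ := hK
  rw [SimpleGraph.connected_iff_exists_forall_reachable]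
  refine ⟨⟨a, Finset.mem_coe.2 ha⟩, ?_⟩
  have key := h (K.filter fun v => ∃ hv : v ∈ (K : Set V),
      (G.induce (K : Set V)).Reachable ⟨a, ha⟩ ⟨v, hv⟩) (Finset.filter_subset _ _)
    ⟨a, Finset.mem_filter.2 ⟨ha, Finset.mem_coe.2 ha, .rfl⟩⟩ (by
      intro u hu v hv huv
      rw [Finset.mem_filter] at hu ⊢
      obtain ⟨-, huK, hr⟩ := hu
      refine ⟨hv, Finset.mem_coe.2 hv, hr.trans (SimpleGraph.Adj.reachable ?_)⟩
      simpa using huv)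
  rintro ⟨v, hv⟩
  obtain ⟨-, _, hr⟩ := Finset.mem_filter.1 (key hv)
  exact hr

theorem of_induce_connected {K : Finset V} (h : (G.induce (K : Set V)).Connected) :
    ConnectedOn G K := by
  obtain ⟨⟨a, ha⟩⟩ := h.nonempty
  refine ⟨⟨a, ha⟩, fun S hS ⟨b, hb⟩ hcl v hv => ?_⟩
  obtain ⟨p⟩ := h.preconnected ⟨b, hS hb⟩ ⟨v, hv⟩
  have key : ∀ x y : (K : Set V), (G.induce (K : Set V)).Walk x y → (x : V) ∈ S → (y : V) ∈ S := by
    intro x y p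
    induction p with
    | nil => exact id
    | cons hxy _ ih => exact fun hx => ih (hcl _ hx _ (Subtype.prop _) (by simpa using hxy))
  exact key _ _ p hb

theorem singleton (v : V) : ConnectedOn G {v} := by
  refine ⟨⟨v, by simp⟩, fun S hS ⟨u, hu⟩ _ => ?_⟩
  have := hS hu
  simp_all

theorem insert {T : Finset V} (hT : ConnectedOn G T) {u v : V} (hv : v ∈ T) (huv : G.Adj v u) :
    ConnectedOn G (insert u T) := by
  refine ⟨⟨u, by simp⟩, fun S hS ⟨x, hx⟩ hcl => ?_⟩
  have hTS : (S ∩ T).Nonempty := by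
    rcases Finset.mem_insert.1 (hS hx) with rfl | hxT
    · exact ⟨v, Finset.mem_inter.2 ⟨hcl _ hx _ (Finset.mem_insert_of_mem hv) huv.symm, hv⟩⟩
    · exact ⟨x, Finset.mem_inter.2 ⟨hx, hxT⟩⟩
  have hsub := hT.2 (S ∩ T) Finset.inter_subset_right hTS (fun a ha b hb hab =>
    Finset.mem_inter.2 ⟨hcl _ (Finset.mem_inter.1 ha).1 _ (Finset.mem_insert_of_mem hb) hab, hb⟩)
  have hTS' : T ⊆ S := fun y hy => (Finset.mem_inter.1 (hsub hy)).1
  exact Finset.insert_subset (hcl _ (hTS' hv) _ (Finset.mem_insert_self _ _) huv) hTS'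

/-- A connected set avoiding the boundary of `W` and meeting `W` lies in `W`. -/
theorem subset_of_closed {K W : Finset V} (hK : ConnectedOn G K) (hKW : (K ∩ W).Nonempty)
    (h : ∀ u ∈ W, ∀ v ∈ K, G.Adj u v → v ∈ W) : K ⊆ W := fun _ hv =>
  (Finset.mem_inter.1 (hK.2 (K ∩ W) Finset.inter_subset_left hKW (fun a ha b hb hab =>
    Finset.mem_inter.2 ⟨hb, h a (Finset.mem_inter.1 ha).2 b hb hab⟩) hv)).2

/-- Every connected subset extends to one that is closed under adjacency. -/
theorem exists_maximal {U K : Finset V} (hK : ConnectedOn G K) (hKU : K ⊆ U) :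
    ∃ L, K ⊆ L ∧ L ⊆ U ∧ ConnectedOn G L ∧ ∀ u ∈ L, ∀ v ∈ U, G.Adj u v → v ∈ L := by
  obtain ⟨L, hL, hmax⟩ := Finset.exists_max_image
    (U.powerset.filter fun L => K ⊆ L ∧ ConnectedOn G L) Finset.card ⟨K, by simp [hK, hKU]⟩
  simp only [Finset.mem_filter, Finset.mem_powerset] at hL hmax
  refine ⟨L, hL.2.1, hL.1, hL.2.2, fun u hu v hv huv => ?_⟩
  by_contra hvL
  have := hmax (Insert.insert v L) ⟨Finset.insert_subset hv hL.1,
    hL.2.1.trans (Finset.subset_insert _ _), hL.2.2.insert hu huv⟩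
  rw [Finset.card_insert_of_notMem hvL] at this
  omega

/-- Given connected `Y ⊆ W` and a connected set `C` disjoint from `W`, with no edge from `C`
to `Y`, the part of `W \ Y` linked to `C` can be moved from `W` to `C`. -/
theorem exists_transfer {W Y C : Finset V} (hW : ConnectedOn G W) (hY : ConnectedOn G Y)
    (hC : ConnectedOn G C) (hYW : Y ⊆ W)
    (hCY : ∀ c ∈ C, ∀ y ∈ Y, ¬ G.Adj c y) :
    ∃ D ⊆ W, Disjoint D Y ∧ (∀ c ∈ C, ∀ w ∈ W, G.Adj c w → w ∈ D) ∧
      (∀ u ∈ D, ∀ v ∈ W, v ∉ Y → G.Adj u v → v ∈ D) ∧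
      ConnectedOn G (C ∪ D) ∧ ConnectedOn G (W \ D) := by
  let good : Finset V → Prop := fun D => (∀ c ∈ C, ∀ w ∈ W, G.Adj c w → w ∈ D) ∧
      (∀ u ∈ D, ∀ v ∈ W, v ∉ Y → G.Adj u v → v ∈ D)
  obtain ⟨D, hD, hmin⟩ := Finset.exists_min_image
    ((W \ Y).powerset.filter good) Finset.card ⟨W \ Y, by
      simp only [Finset.mem_filter, Finset.mem_powerset, subset_refl, true_and]
      exact ⟨fun c hc w hw h => Finset.mem_sdiff.2 ⟨hw, fun hy => hCY c hc w hy h⟩,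
        fun u _ v hv hvY _ => Finset.mem_sdiff.2 ⟨hv, hvY⟩⟩⟩
  simp only [Finset.mem_filter, Finset.mem_powerset] at hD hmin
  obtain ⟨hDWY, hDC, hDcl⟩ := hD
  have hmin' : ∀ E ⊆ D, good E → D ⊆ E := fun E hE hg =>
    (Finset.eq_of_subset_of_card_le hE (hmin E ⟨hE.trans hDWY, hg⟩)).ge
  have hDY : Disjoint D Y := Finset.disjoint_of_subset_left hDWY Finset.sdiff_disjoint
  have hDW : D ⊆ W := hDWY.trans Finset.sdiff_subset
  obtain ⟨y, hy⟩ := hY.1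
  refine ⟨D, hDW, hDY, hDC, hDcl, ⟨hC.1.mono Finset.subset_union_left, ?_⟩,
    ⟨⟨y, Finset.mem_sdiff.2 ⟨hYW hy, fun h => Finset.disjoint_left.1 hDY h hy⟩⟩, ?_⟩⟩
  · intro S hS hne hcl
    by_cases hSC : (C ∩ S).Nonempty
    · have hCS : C ⊆ S := hC.subset_of_closed hSC fun u hu v hv huv =>
        hcl u hu v (Finset.mem_union_left _ hv) huv
      refine Finset.union_subset hCS ((hmin' (D ∩ S) Finset.inter_subset_left ⟨?_, ?_⟩).trans
        Finset.inter_subset_right)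
      · intro c hc w hw h
        have hwD := hDC c hc w hw h
        exact Finset.mem_inter.2 ⟨hwD, hcl c (hCS hc) w (Finset.mem_union_right _ hwD) h⟩
      · intro u hu v hv hvY h
        rw [Finset.mem_inter] at hu
        have hvD := hDcl u hu.1 v hv hvY h
        exact Finset.mem_inter.2 ⟨hvD, hcl u hu.2 v (Finset.mem_union_right _ hvD) h⟩
    · exfalso
      have hnot : ∀ c ∈ C, c ∉ S := fun c hc hs => hSC ⟨c, Finset.mem_inter.2 ⟨hc, hs⟩⟩
      have hsub := hmin' (D \ S) Finset.sdiff_subset ⟨fun c hc w hw h =>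
          Finset.mem_sdiff.2 ⟨hDC c hc w hw h, fun hs =>
            hnot c hc (hcl w hs c (Finset.mem_union_left _ hc) h.symm)⟩,
        fun u hu v hv hvY h => by
          rw [Finset.mem_sdiff] at hu
          exact Finset.mem_sdiff.2 ⟨hDcl u hu.1 v hv hvY h, fun hs =>
            hu.2 (hcl v hs u (Finset.mem_union_right _ hu.1) h.symm)⟩⟩
      obtain ⟨x, hx⟩ := hne
      rcases Finset.mem_union.1 (hS hx) with h | h
      · exact hnot x h hx
      · exact (Finset.mem_sdiff.1 (hsub h)).2 hx
  · intro S hS hne hcl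
    have closed : ∀ E ⊆ W \ D, Disjoint E Y →
        (∀ u ∈ E, ∀ v ∈ W \ D, G.Adj u v → v ∈ E) → E = ∅ := by
      intro E hE hEY hEcl
      by_contra hEne
      have := hW.2 E (hE.trans Finset.sdiff_subset) (Finset.nonempty_iff_ne_empty.2 hEne)
        (fun u hu v hv huv => by
          refine hEcl u hu v (Finset.mem_sdiff.2 ⟨hv, fun hvD => ?_⟩) huv
          have huWD := Finset.mem_sdiff.1 (hE hu)
          exact huWD.2 (hDcl v hvD u huWD.1 (Finset.disjoint_left.1 hEY hu) huv.symm))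
      exact Finset.disjoint_left.1 hEY (this (hYW hy)) hy
    have hYWD : ∀ v ∈ Y, v ∈ W \ D := fun v hv =>
      Finset.mem_sdiff.2 ⟨hYW hv, fun h => Finset.disjoint_left.1 hDY h hv⟩
    have hSY : (Y ∩ S).Nonempty := by
      by_contra hSY
      refine hne.ne_empty (closed S hS (Finset.disjoint_left.2 fun v hv hvY => hSY ⟨v, ?_⟩) hcl)
      exact Finset.mem_inter.2 ⟨hvY, hv⟩
    have hYS : Y ⊆ S := hY.subset_of_closed hSY fun u hu v hv huv => hcl u hu v (hYWD v hv) huv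
    have := closed ((W \ D) \ S) Finset.sdiff_subset
      (Finset.disjoint_left.2 fun v hv hvY => (Finset.mem_sdiff.1 hv).2 (hYS hvY))
      (fun u hu v hv huv => by
        rw [Finset.mem_sdiff] at hu
        exact Finset.mem_sdiff.2 ⟨hv, fun hvS => hu.2 (hcl v hvS u hu.1 huv.symm)⟩)
    exact Finset.sdiff_eq_empty_iff_subset.1 this

end ConnectedOn

section Separators

variable {V : Type*} {G : SimpleGraph V}

/-- Either a small connected subset of `W` meets all of the sets `A j`, or a small set `Z`
prevents every connected subset of `W \ Z` from doing so. -/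
theorem exists_connectedOn_or_separator (W : Finset V) (A : ℕ → Finset V) (t s : ℕ) (hs : 0 < s) :
    (∃ T ⊆ W, ConnectedOn G T ∧ T.card ≤ s ∧ ∀ j < t, (T ∩ A j).Nonempty) ∨
    ∃ Z ⊆ W, s * Z.card ≤ (t + 1) * W.card ∧
      ∀ K ⊆ W \ Z, ConnectedOn G K → ∃ j < t, Disjoint K (A j) := by
  let P : ℕ → ℕ → V → Prop := fun i n v =>
    ∃ T ⊆ W, ConnectedOn G T ∧ v ∈ T ∧ T.card ≤ n ∧ ∀ j < i, (T ∩ A j).Nonempty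
  let Z : ℕ → Finset V := fun l => W.filter fun v => ∃ i ≤ t, P i (l + 1) v ∧ ¬ P i l v
  have hsum : ∑ l ∈ Finset.range s, (Z l).card ≤ (t + 1) * W.card := by
    have hle : ∀ l ∈ Finset.range s, (Z l).card ≤ ∑ v ∈ W, ∑ i ∈ Finset.range (t + 1),
        if P i (l + 1) v ∧ ¬ P i l v then 1 else 0 := by
      intro l _
      rw [Finset.card_filter]
      refine Finset.sum_le_sum fun v _ => ?_
      split_ifs with h
      · obtain ⟨i, hi, h⟩ := h
        refine le_trans (by rw [if_pos h]) (Finset.single_le_sum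
          (f := fun i => if P i (l + 1) v ∧ ¬ P i l v then 1 else 0)
          (fun _ _ => Nat.zero_le _) (Finset.mem_range.2 (Nat.lt_succ_of_le hi)))
      · exact Nat.zero_le _
    refine (Finset.sum_le_sum hle).trans ?_
    rw [Finset.sum_comm]
    calc _ ≤ ∑ _v ∈ W, (t + 1) := Finset.sum_le_sum fun v _ => ?_
      _ = (t + 1) * W.card := by simp [mul_comm]
    rw [Finset.sum_comm]
    calc _ ≤ ∑ _i ∈ Finset.range (t + 1), 1 := Finset.sum_le_sum fun i _ => ?_
      _ = t + 1 := by simp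
    rw [← Finset.card_filter, Finset.card_le_one]
    have hmono : ∀ a b, a ≤ b → P i a v → P i b v := fun a b hab ⟨T, h1, h2, h3, h4, h5⟩ =>
      ⟨T, h1, h2, h3, h4.trans hab, h5⟩
    intro a ha b hb
    rw [Finset.mem_filter] at ha hb
    rcases lt_trichotomy a b with h | h | h
    · exact absurd (hmono _ _ h ha.2.1) hb.2.2
    · exact h
    · exact absurd (hmono _ _ h hb.2.1) ha.2.2
  obtain ⟨l, hl, hlcard⟩ : ∃ l < s, s * (Z l).card ≤ (t + 1) * W.card := by
    by_contra! hcon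
    obtain ⟨l, hl, hmin⟩ := Finset.exists_min_image (Finset.range s) (fun l => (Z l).card)
      ⟨0, Finset.mem_range.2 hs⟩
    have h1 := Finset.card_nsmul_le_sum (Finset.range s) (fun l => (Z l).card) _ hmin
    have h2 := hcon l (Finset.mem_range.1 hl)
    simp only [Finset.card_range, smul_eq_mul] at h1
    omega
  refine or_iff_not_imp_left.2 fun hno => ⟨Z l, Finset.filter_subset _ _, hlcard, ?_⟩
  intro K hK hKc
  by_contra! hmeet
  have hW : ∀ v ∈ K, v ∈ W := fun v hv => (Finset.mem_sdiff.1 (hK hv)).1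
  have hdrop : ∀ i ≤ t, ∀ v ∈ K, P i (l + 1) v → P i l v := by
    intro i hi v hv hP
    by_contra hn
    exact (Finset.mem_sdiff.1 (hK hv)).2 (Finset.mem_filter.2 ⟨hW v hv, i, hi, hP, hn⟩)
  have key : ∀ i ≤ t, ∀ v ∈ K, P i l v := by
    intro i
    induction i with
    | zero =>
      intro hi v hv
      exact hdrop 0 hi v hv ⟨{v}, by simpa using hW v hv, .singleton v, by simp, by simp, by simp⟩
    | succ i ih =>
      intro hi
      obtain ⟨x, hxK, hxA⟩ := Finset.not_disjoint_iff.1 (hmeet i hi)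
      obtain ⟨T, h1, h2, h3, h4, h5⟩ := ih (by omega) x hxK
      have hx : P (i + 1) l x := ⟨T, h1, h2, h3, h4, fun j hj => by
        rcases Nat.lt_succ_iff_lt_or_eq.1 hj with hj | rfl
        · exact h5 j hj
        · exact ⟨x, Finset.mem_inter.2 ⟨h3, hxA⟩⟩⟩
      have hsub := hKc.2 (K.filter (P (i + 1) l)) (Finset.filter_subset _ _)
        ⟨x, Finset.mem_filter.2 ⟨hxK, hx⟩⟩ (fun u hu v hv huv => by
          obtain ⟨-, T, h1, h2, h3, h4, h5⟩ := Finset.mem_filter.1 hu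
          refine Finset.mem_filter.2 ⟨hv, hdrop _ hi v hv ⟨insert v T, ?_, h2.insert h3 huv,
            Finset.mem_insert_self _ _, (Finset.card_insert_le _ _).trans (by omega), ?_⟩⟩
          · exact Finset.insert_subset (hW v hv) h1
          · exact fun j hj => (h5 j hj).mono
              (Finset.inter_subset_inter_right (Finset.subset_insert _ _)))
      exact fun v hv => (Finset.mem_filter.1 (hsub hv)).2
  obtain ⟨x, hx⟩ := hKc.1
  obtain ⟨T, h1, h2, -, h4, h5⟩ := key t le_rfl x hx
  exact hno ⟨T, h1, h2, by omega, h5⟩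

/-- A clique model `F` in `G` controlling the boundary in `U` of a connected set `W` with more than
half of the vertices of `U`. -/
structure CliqueModelAround (G : SimpleGraph V) (U : Finset V) (s : ℕ) (F : Finset (Finset V))
    (W : Finset V) : Prop where
  subset : W ⊆ U
  connected : ConnectedOn G W
  large : U.card < 2 * W.card
  branch_connected : ∀ C ∈ F, ConnectedOn G C
  branch_disjoint : ∀ C ∈ F, Disjoint C W
  pairwise_disjoint : ∀ C ∈ F, ∀ C' ∈ F, C ≠ C' → Disjoint C C'
  pairwise_adj : ∀ C ∈ F, ∀ C' ∈ F, C ≠ C' → ∃ u ∈ C, ∃ v ∈ C', G.Adj u v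
  boundary : ∀ u ∈ U, u ∉ W → ∀ w ∈ W, G.Adj u w → ∃ C ∈ F, u ∈ C
  boundary_card : ∀ C ∈ F, (C.filter fun u => ∃ w ∈ W, G.Adj u w).card ≤ s

namespace CliqueModelAround

variable {U W : Finset V} {s : ℕ} {F : Finset (Finset V)}

theorem hasMinor (h : CliqueModelAround G U s F W) {r : ℕ} (H : SimpleGraph (Fin r))
    (hr : r ≤ F.card) : HasMinor G H := by
  obtain ⟨F', hF', hcard⟩ := Finset.exists_subset_card_eq hr
  let e : Fin r ≃ F' := (F'.equivFinOfCardEq hcard).symm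
  have hmem : ∀ i, (e i : Finset V) ∈ F := fun i => hF' (e i).2
  have hne : ∀ i j, i ≠ j → (e i : Finset V) ≠ e j := fun i j hij he =>
    hij (e.injective (Subtype.ext he))
  refine ⟨fun i => (e i : Finset V), fun i => ?_, fun i => ?_, fun i j hij => ?_, fun i j hij => ?_⟩
  · exact_mod_cast (h.branch_connected _ (hmem i)).1
  · exact (h.branch_connected _ (hmem i)).induce_connected
  · exact Finset.disjoint_coe.2 <| h.pairwise_disjoint _ (hmem i) _ (hmem j) (hne i j hij)
  · exact_mod_cast h.pairwise_adj _ (hmem i) _ (hmem j) (hne i j hij.ne)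

/-- Branch sets without an edge to `W` may be discarded. -/
theorem erase (h : CliqueModelAround G U s F W) {C : Finset V}
    (hC : ∀ c ∈ C, ∀ w ∈ W, ¬ G.Adj c w) : CliqueModelAround G U s (F.erase C) W where
  subset := h.subset
  connected := h.connected
  large := h.large
  branch_connected C' hC' := h.branch_connected C' (Finset.mem_of_mem_erase hC')
  branch_disjoint C' hC' := h.branch_disjoint C' (Finset.mem_of_mem_erase hC')
  pairwise_disjoint C₁ h₁ C₂ h₂ := h.pairwise_disjoint C₁ (Finset.mem_of_mem_erase h₁) C₂
    (Finset.mem_of_mem_erase h₂)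
  pairwise_adj C₁ h₁ C₂ h₂ := h.pairwise_adj C₁ (Finset.mem_of_mem_erase h₁) C₂
    (Finset.mem_of_mem_erase h₂)
  boundary u hu huW w hw huw := by
    obtain ⟨C', hC', huC'⟩ := h.boundary u hu huW w hw huw
    refine ⟨C', Finset.mem_erase.2 ⟨?_, hC'⟩, huC'⟩
    rintro rfl
    exact hC u huC' w hw huw
  boundary_card C' hC' := h.boundary_card C' (Finset.mem_of_mem_erase hC')

/-- If small sets do not separate `U`, then removing a small `Z ⊆ W` along with the boundary
of `W` leaves a large connected subset of `W`. -/
theorem exists_large (h : CliqueModelAround G U s F W) {N : ℕ}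
    (hbig : ∀ X : Finset V, X.card ≤ N → ∃ K ⊆ U \ X, ConnectedOn G K ∧ U.card < 2 * K.card)
    {Z : Finset V} (hZ : Z.card ≤ s) (hN : (F.card + 1) * s ≤ N) :
    ∃ Y ⊆ W \ Z, ConnectedOn G Y ∧ U.card < 2 * Y.card ∧
      ∀ y ∈ Y, ∀ v ∈ W, G.Adj y v → v ∈ Y ∨ v ∈ Z := by
  let B := F.biUnion fun C => C.filter fun u => ∃ w ∈ W, G.Adj u w
  have hB : B.card ≤ F.card * s := Finset.card_biUnion_le_card_mul _ _ _ h.boundary_card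
  obtain ⟨K, hKU, hK, hKl⟩ := hbig (B ∪ Z) ((Finset.card_union_le _ _).trans (by linarith))
  obtain ⟨Y, hKY, hYU, hY, hYcl⟩ := hK.exists_maximal hKU
  have hYl : U.card < 2 * Y.card := by
    have := Finset.card_le_card hKY
    omega
  have hYU' : Y ⊆ U := hYU.trans Finset.sdiff_subset
  have hinter : (Y ∩ W).Nonempty := by
    rw [← Finset.card_pos]
    have h1 := Finset.card_union_add_card_inter Y W
    have h2 := Finset.card_le_card (Finset.union_subset hYU' h.subset)
    have h3 := h.large
    omega
  have hnot : ∀ y ∈ Y, y ∉ B ∧ y ∉ Z := fun y hy => by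
    have := (Finset.mem_sdiff.1 (hYU hy)).2
    rwa [Finset.mem_union, not_or] at this
  have hYW : Y ⊆ W := by
    refine hY.subset_of_closed hinter fun u hu v hv huv => ?_
    by_contra hvW
    obtain ⟨C, hC, hvC⟩ := h.boundary v (hYU' hv) hvW u hu huv.symm
    exact (hnot v hv).1 (Finset.mem_biUnion.2
      ⟨C, hC, Finset.mem_filter.2 ⟨hvC, u, hu, huv.symm⟩⟩)
  refine ⟨Y, fun y hy => Finset.mem_sdiff.2 ⟨hYW hy, (hnot y hy).2⟩, hY, hYl, ?_⟩
  intro y hy v hv hyv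
  by_contra! hcon
  refine hcon.1 (hYcl y hy v (Finset.mem_sdiff.2 ⟨h.subset hv, fun hvX => ?_⟩) hyv)
  rcases Finset.mem_union.1 hvX with hvB | hvZ
  · obtain ⟨C, hC, hvC⟩ := Finset.mem_biUnion.1 hvB
    exact Finset.disjoint_left.1 (h.branch_disjoint C hC) (Finset.mem_filter.1 hvC).1 hv
  · exact hcon.2 hvZ

theorem boundary_card_mono (h : CliqueModelAround G U s F W) {Y C : Finset V} (hYW : Y ⊆ W)
    (hC : C ∈ F) : (C.filter fun u => ∃ w ∈ Y, G.Adj u w).card ≤ s :=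
  (Finset.card_le_card (Finset.monotone_filter_right _ fun _ _ ⟨w, hw, huw⟩ =>
    ⟨w, hYW hw, huw⟩)).trans (h.boundary_card C hC)

/-- A small connected subset of `W` adjacent to all branch sets becomes a branch set. -/
theorem extend (h : CliqueModelAround G U s F W) {T Y : Finset V} (hTW : T ⊆ W)
    (hT : ConnectedOn G T) (hTs : T.card ≤ s) (hadj : ∀ C ∈ F, ∃ u ∈ C, ∃ v ∈ T, G.Adj u v)
    (hYT : Y ⊆ W \ T) (hY : ConnectedOn G Y) (hYl : U.card < 2 * Y.card)
    (hYcl : ∀ y ∈ Y, ∀ v ∈ W, G.Adj y v → v ∈ Y ∨ v ∈ T) :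
    CliqueModelAround G U s (insert T F) Y := by
  have hYW : Y ⊆ W := hYT.trans Finset.sdiff_subset
  have hTd : ∀ C ∈ F, Disjoint C T := fun C hC =>
    Finset.disjoint_of_subset_right hTW (h.branch_disjoint C hC)
  refine ⟨hYW.trans h.subset, hY, hYl, ?_, ?_, ?_, ?_, ?_, ?_⟩
  · simpa [hT] using h.branch_connected
  · intro C hC
    rcases Finset.mem_insert.1 hC with rfl | hC
    · exact (Finset.disjoint_of_subset_left hYT Finset.sdiff_disjoint).symm
    · exact Finset.disjoint_of_subset_right hYW (h.branch_disjoint C hC)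
  · intro C hC C' hC' hne
    rcases Finset.mem_insert.1 hC with h₁ | h₁ <;> rcases Finset.mem_insert.1 hC' with h₂ | h₂
    · exact absurd (h₁.trans h₂.symm) hne
    · exact h₁ ▸ (hTd C' h₂).symm
    · exact h₂ ▸ hTd C h₁
    · exact h.pairwise_disjoint C h₁ C' h₂ hne
  · intro C hC C' hC' hne
    rcases Finset.mem_insert.1 hC with h₁ | h₁ <;> rcases Finset.mem_insert.1 hC' with h₂ | h₂
    · exact absurd (h₁.trans h₂.symm) hne
    · obtain ⟨u, hu, v, hv, huv⟩ := hadj C' h₂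
      exact ⟨v, h₁ ▸ hv, u, hu, huv.symm⟩
    · exact h₂ ▸ hadj C h₁
    · exact h.pairwise_adj C h₁ C' h₂ hne
  · intro u hu huY y hy huy
    by_cases huW : u ∈ W
    · exact ⟨T, Finset.mem_insert_self _ _, (hYcl y hy u huW huy.symm).resolve_left huY⟩
    · obtain ⟨C, hC, huC⟩ := h.boundary u hu huW y (hYW hy) huy
      exact ⟨C, Finset.mem_insert_of_mem hC, huC⟩
  · intro C hC
    rcases Finset.mem_insert.1 hC with rfl | hC
    · exact (Finset.card_filter_le _ _).trans hTs
    · exact h.boundary_card_mono hYW hC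

/-- A branch set without an edge to the large part `Y` of `W` absorbs the part of `W \ Y` linked
to it. -/
theorem exists_absorb (h : CliqueModelAround G U s F W) {C Y Z : Finset V} (hC : C ∈ F)
    (hCW : ∃ c ∈ C, ∃ w ∈ W, G.Adj c w) (hCY : ∀ c ∈ C, ∀ y ∈ Y, ¬ G.Adj c y)
    (hZs : Z.card ≤ s) (hYW : Y ⊆ W) (hY : ConnectedOn G Y) (hYl : U.card < 2 * Y.card)
    (hYcl : ∀ y ∈ Y, ∀ v ∈ W, G.Adj y v → v ∈ Y ∨ v ∈ Z) :
    ∃ F' W', CliqueModelAround G U s F' W' ∧ F'.card ≤ F.card ∧ W'.card < W.card := by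
  obtain ⟨D, hDW, hDY, hDC, hDcl, hCD, hWD⟩ :=
    ConnectedOn.exists_transfer h.connected hY (h.branch_connected C hC) hYW hCY
  have hdisj : ∀ C' ∈ F, C ≠ C' → Disjoint (C ∪ D) C' := fun C' hC' hne =>
    Finset.disjoint_union_left.2 ⟨h.pairwise_disjoint C hC C' hC' hne,
      (Finset.disjoint_of_subset_right hDW (h.branch_disjoint C' hC')).symm⟩
  have hadj : ∀ C' ∈ F, C ≠ C' → ∃ u ∈ C ∪ D, ∃ v ∈ C', G.Adj u v := fun C' hC' hne => by
    obtain ⟨u, hu, v⟩ := h.pairwise_adj C hC C' hC' hne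
    exact ⟨u, Finset.mem_union_left _ hu, v⟩
  have hmem : ∀ C', C' ∈ insert (C ∪ D) (F.erase C) → C' = C ∪ D ∨ C' ∈ F ∧ C ≠ C' := by
    intro C' hC'
    rw [Finset.mem_insert, Finset.mem_erase] at hC'
    exact hC'.imp_right fun h => ⟨h.2, h.1.symm⟩
  refine ⟨insert (C ∪ D) (F.erase C), W \ D,
    ⟨Finset.sdiff_subset.trans h.subset, hWD, ?_, ?_, ?_, ?_, ?_, ?_, ?_⟩, ?_, ?_⟩
  · have : Y ⊆ W \ D := Finset.subset_sdiff.2 ⟨hYW, hDY.symm⟩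
    have := Finset.card_le_card this
    omega
  · intro C' hC'
    rcases hmem C' hC' with rfl | ⟨hC', -⟩
    · exact hCD
    · exact h.branch_connected C' hC'
  · intro C' hC'
    rcases hmem C' hC' with rfl | ⟨hC', -⟩
    · exact Finset.disjoint_union_left.2 ⟨Finset.disjoint_of_subset_right Finset.sdiff_subset
        (h.branch_disjoint C hC), Finset.disjoint_sdiff⟩
    · exact Finset.disjoint_of_subset_right Finset.sdiff_subset (h.branch_disjoint C' hC')
  · intro C₁ h₁ C₂ h₂ hne
    rcases hmem C₁ h₁ with rfl | h₁ <;> rcases hmem C₂ h₂ with rfl | h₂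
    · exact absurd rfl hne
    · exact hdisj C₂ h₂.1 h₂.2
    · exact (hdisj C₁ h₁.1 h₁.2).symm
    · exact h.pairwise_disjoint C₁ h₁.1 C₂ h₂.1 hne
  · intro C₁ h₁ C₂ h₂ hne
    rcases hmem C₁ h₁ with rfl | h₁ <;> rcases hmem C₂ h₂ with rfl | h₂
    · exact absurd rfl hne
    · exact hadj C₂ h₂.1 h₂.2
    · obtain ⟨u, hu, v, hv, huv⟩ := hadj C₁ h₁.1 h₁.2
      exact ⟨v, hv, u, hu, huv.symm⟩
    · exact h.pairwise_adj C₁ h₁.1 C₂ h₂.1 hne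
  · intro u hu huWD w hw huw
    by_cases huD : u ∈ D
    · exact ⟨_, Finset.mem_insert_self _ _, Finset.mem_union_right _ huD⟩
    · have huW : u ∉ W := fun huW => huWD (Finset.mem_sdiff.2 ⟨huW, huD⟩)
      obtain ⟨C', hC', huC'⟩ := h.boundary u hu huW w (Finset.mem_sdiff.1 hw).1 huw
      by_cases hCC : C = C'
      · exact ⟨_, Finset.mem_insert_self _ _, Finset.mem_union_left _ (hCC ▸ huC')⟩
      · exact ⟨C', Finset.mem_insert_of_mem (Finset.mem_erase.2 ⟨Ne.symm hCC, hC'⟩), huC'⟩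
  · intro C' hC'
    rcases hmem C' hC' with rfl | ⟨hC', -⟩
    · refine (Finset.card_le_card fun u hu => ?_).trans hZs
      obtain ⟨hu, w, hw, huw⟩ := Finset.mem_filter.1 hu
      obtain ⟨hwW, hwD⟩ := Finset.mem_sdiff.1 hw
      rcases Finset.mem_union.1 hu with hu | hu
      · exact absurd (hDC u hu w hwW huw) hwD
      · by_cases hwY : w ∈ Y
        · exact (hYcl w hwY u (hDW hu) huw.symm).resolve_left (Finset.disjoint_left.1 hDY hu)
        · exact absurd (hDcl u hu w hwW hwY huw) hwD
    · exact h.boundary_card_mono Finset.sdiff_subset hC'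
  · have h1 := Finset.card_insert_le (C ∪ D) (F.erase C)
    have h2 := Finset.card_erase_add_one hC
    omega
  · obtain ⟨c, hc, w, hw, hcw⟩ := hCW
    exact Finset.card_lt_card (Finset.sdiff_ssubset hDW ⟨w, hDC c hc w hw hcw⟩)

/-- If small sets do not separate `U`, a model with fewer than `r` branch sets can be improved. -/
theorem exists_improvement (h : CliqueModelAround G U s F W) {r : ℕ}
    (hbig : ∀ X : Finset V, X.card ≤ r * s →
      ∃ K ⊆ U \ X, ConnectedOn G K ∧ U.card < 2 * K.card)
    (hs : 0 < s) (hrs : r * U.card ≤ s * s) (hF : F.card < r) :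
    ∃ F' W', CliqueModelAround G U s F' W' ∧
      2 * W'.card + F'.card < 2 * W.card + F.card := by
  by_cases hCW : ∀ C ∈ F, ∃ c ∈ C, ∃ w ∈ W, G.Adj c w
  swap
  · push Not at hCW
    obtain ⟨C, hC, hCW⟩ := hCW
    refine ⟨F.erase C, W, h.erase hCW, ?_⟩
    have := Finset.card_erase_add_one hC
    omega
  have hN : (F.card + 1) * s ≤ r * s := Nat.mul_le_mul_right _ hF
  let f : ℕ → Finset V := fun j => F.toList.getD j ∅
  have hf : ∀ j < F.card, f j ∈ F := fun j hj => by
    have hj' : j < F.toList.length := by simpa using hj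
    have : f j = F.toList[j] := List.getD_eq_getElem _ _ hj'
    rw [this, ← Finset.mem_toList]
    exact List.getElem_mem _
  have hf' : ∀ C ∈ F, ∃ j < F.card, f j = C := fun C hC => by
    obtain ⟨j, hj, hjC⟩ := List.getElem_of_mem (Finset.mem_toList.2 hC)
    exact ⟨j, by simpa using hj, (List.getD_eq_getElem _ _ hj).trans hjC⟩
  rcases exists_connectedOn_or_separator (G := G) W
      (fun j => W.filter fun w => ∃ c ∈ f j, G.Adj c w) F.card s hs with
    ⟨T, hTW, hT, hTs, hTA⟩ | ⟨Z, hZW, hZ, hZA⟩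
  · obtain ⟨Y, hYW, hY, hYl, hYcl⟩ := h.exists_large hbig hTs hN
    refine ⟨insert T F, Y, h.extend hTW hT hTs (fun C hC => ?_) hYW hY hYl hYcl, ?_⟩
    · obtain ⟨j, hj, rfl⟩ := hf' C hC
      obtain ⟨x, hx⟩ := hTA j hj
      obtain ⟨hxT, hxA⟩ := Finset.mem_inter.1 hx
      obtain ⟨-, c, hc, hcx⟩ := Finset.mem_filter.1 hxA
      exact ⟨c, hc, x, hxT, hcx⟩
    · have h1 := Finset.card_insert_le T F
      have h2 := Finset.card_le_card hYW
      have h3 := Finset.card_sdiff_add_card_eq_card hTW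
      have h4 := hT.1.card_pos
      omega
  · have hZs : Z.card ≤ s := by
      refine Nat.le_of_mul_le_mul_left (hZ.trans ((Nat.mul_le_mul ?_ ?_).trans hrs)) hs
      · exact hF
      · exact Finset.card_le_card h.subset
    obtain ⟨Y, hYW, hY, hYl, hYcl⟩ := h.exists_large hbig hZs hN
    obtain ⟨j, hj, hjY⟩ := hZA Y hYW hY
    have hYW' := hYW.trans Finset.sdiff_subset
    obtain ⟨F', W', h', h1, h2⟩ := h.exists_absorb (hf j hj) (hCW _ (hf j hj))
      (fun c hc y hy hcy => Finset.disjoint_left.1 hjY hy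
        (Finset.mem_filter.2 ⟨hYW' hy, c, hc, hcy⟩)) hZs hYW' hY hYl hYcl
    exact ⟨F', W', h', by omega⟩

end CliqueModelAround

/-- **Alon–Seymour–Thomas separator theorem.** -/
theorem exists_balanced_separator {r : ℕ} {H : SimpleGraph (Fin r)} (hG : ¬ HasMinor G H)
    (U : Finset V) {s : ℕ} (hs : 0 < s) (hrs : r * U.card ≤ s * s) :
    ∃ X : Finset V, X.card ≤ r * s ∧ ∀ K ⊆ U \ X, ConnectedOn G K → 2 * K.card ≤ U.card := by
  by_contra! hbig
  have key : ∀ N F W, CliqueModelAround G U s F W → 2 * W.card + F.card = N → False := by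
    intro N
    induction N using Nat.strong_induction_on with
    | _ N ih =>
      intro F W h hN
      obtain ⟨F', W', h', hlt⟩ := h.exists_improvement hbig hs hrs
        (lt_of_not_ge fun hr => hG (h.hasMinor H hr))
      exact ih _ (hN ▸ hlt) F' W' h' rfl
  obtain ⟨K, hKU, hK, hKl⟩ := hbig ∅ (by simp)
  rw [Finset.sdiff_empty] at hKU
  obtain ⟨W, hKW, hWU, hW, hWcl⟩ := hK.exists_maximal hKU
  refine key _ ∅ W ⟨hWU, hW, ?_, by simp, by simp, by simp, by simp, ?_, by simp⟩ rfl
  · have := Finset.card_le_card hKW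
    omega
  · exact fun u hu huW w hw huw => absurd (hWcl w hw u hu huw.symm) huW

/-- Linear bounds for splitting connected sets extend to arbitrary sets. -/
theorem exists_splitting_of_connectedOn {k : ℕ} {c : ℝ} (U : Finset V)
    (h : ∀ K ⊆ U, ConnectedOn G K → ∃ A : Finset V, (A.card : ℝ) ≤ c * K.card ∧
      ∀ L ⊆ K \ A, ConnectedOn G L → L.card ≤ k) :
    ∃ A : Finset V, (A.card : ℝ) ≤ c * U.card ∧
      ∀ L ⊆ U \ A, ConnectedOn G L → L.card ≤ k := by
  induction U using Finset.strongInduction with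
  | _ U ih =>
    rcases U.eq_empty_or_nonempty with rfl | ⟨v, hv⟩
    · exact ⟨∅, by simp, fun L hL _ => by simp [Finset.subset_empty.1 hL]⟩
    obtain ⟨K, hvK, hKU, hK, hKcl⟩ := (ConnectedOn.singleton (G := G) v).exists_maximal
      (Finset.singleton_subset_iff.2 hv)
    have hss : U \ K ⊂ U := Finset.sdiff_ssubset hKU hK.1
    obtain ⟨A, hA, hAk⟩ := h K hKU hK
    obtain ⟨A', hA', hAk'⟩ := ih _ hss fun L hL => h L (hL.trans hss.subset)
    refine ⟨A ∪ A', ?_, fun L hL hLc => ?_⟩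
    · have h1 : ((A ∪ A').card : ℝ) ≤ A.card + A'.card := by exact_mod_cast Finset.card_union_le _ _
      have h2 : (U.card : ℝ) = (U \ K).card + K.card := by
        exact_mod_cast (Finset.card_sdiff_add_card_eq_card hKU).symm
      rw [h2]
      linarith
    · have hLU : ∀ x ∈ L, x ∈ U ∧ x ∉ A ∧ x ∉ A' := fun x hx => by simpa using hL hx
      by_cases hLK : (L ∩ K).Nonempty
      · have := hLc.subset_of_closed hLK fun u hu v hv huv => hKcl u hu v (hLU v hv).1 huv
        exact hAk L (fun x hx => Finset.mem_sdiff.2 ⟨this hx, (hLU x hx).2.1⟩) hLc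
      · refine hAk' L (fun x hx => ?_) hLc
        simp only [Finset.mem_sdiff]
        exact ⟨⟨(hLU x hx).1, fun hxK => hLK ⟨x, Finset.mem_inter.2 ⟨hx, hxK⟩⟩⟩, (hLU x hx).2.2⟩

theorem exists_splitting {r : ℕ} {H : SimpleGraph (Fin r)} (hG : ¬ HasMinor G H) {k : ℕ}
    (hk : 0 < k) (U : Finset V) (hU : k < U.card) :
    ∃ A : Finset V,
      (A.card : ℝ) ≤ 6 * (r * √r) * (2 * U.card / √k - √U.card) ∧
      ∀ L ⊆ U \ A, ConnectedOn G L → L.card ≤ k := by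
  induction hm : U.card using Nat.strong_induction_on generalizing U with
  | _ m ih =>
    subst hm
    set m := U.card with hm
    have hr : 1 ≤ r := by
      by_contra hr
      obtain rfl : r = 0 := by omega
      exact hG ⟨fun i => i.elim0, fun i => i.elim0, fun i => i.elim0, fun i => i.elim0,
        fun i => i.elim0⟩
    have hk0 : (0 : ℝ) < √k := by positivity
    have hkm : √(k : ℝ) ≤ √m := Real.sqrt_le_sqrt (by exact_mod_cast hU.le)
    have hm0 : 0 < √(m : ℝ) := hk0.trans_le hkm
    have hr1 : (1 : ℝ) ≤ r := by exact_mod_cast hr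
    obtain ⟨X, hX, hXK⟩ := exists_balanced_separator hG U (s := Nat.sqrt (r * m) + 1)
      (Nat.succ_pos _) (Nat.lt_succ_sqrt _).le
    have hXR : (X.card : ℝ) ≤ 2 * (r * √r) * √m := by
      have h1 : (X.card : ℝ) ≤ r * (Nat.sqrt (r * m) + 1) := by exact_mod_cast hX
      have h2 : ((Nat.sqrt (r * m) : ℕ) : ℝ) ≤ √r * √m := by
        rw [← Real.sqrt_mul (by positivity)]
        exact_mod_cast Real.nat_sqrt_le_real_sqrt (a := r * m)
      have h3 : (1 : ℝ) ≤ √r * √m := by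
        have h4 : (1 : ℝ) ≤ √r := Real.one_le_sqrt.2 hr1
        have h5 : (1 : ℝ) ≤ √m := Real.one_le_sqrt.2 (by exact_mod_cast (by omega : 1 ≤ m))
        nlinarith
      calc (X.card : ℝ) ≤ r * (Nat.sqrt (r * m) + 1) := h1
        _ ≤ r * (2 * (√r * √m)) := by gcongr; linarith
        _ = 2 * (r * √r) * √m := by ring
    set S : ℝ := r * √r with hS
    have hS0 : 0 ≤ S := by positivity
    have hcoef : 0 ≤ 2 / √(k : ℝ) - 7 / 5 / √m := by
      rw [sub_nonneg]
      gcongr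
      norm_num
    obtain ⟨A, hA, hAk⟩ := exists_splitting_of_connectedOn (G := G) (k := k)
      (c := 6 * S * (2 / √k - 7 / 5 / √m)) (U \ X) fun K hK hKc => by
        by_cases hKk : K.card ≤ k
        · exact ⟨∅, by simp only [Finset.card_empty, Nat.cast_zero]; positivity,
            fun L hL _ => (Finset.card_le_card (hL.trans Finset.sdiff_subset)).trans hKk⟩
        · have hK2 := hXK K hK hKc
          obtain ⟨A, hA, hAk⟩ := ih K.card (by omega) K (by omega) rfl
          refine ⟨A, hA.trans ?_, hAk⟩
          have hsq : 7 / 5 * (K.card : ℝ) / √m ≤ √K.card := by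
            rw [div_le_iff₀ hm0, ← Real.sqrt_mul (by positivity)]
            apply Real.le_sqrt_of_sq_le
            have : (2 : ℝ) * K.card ≤ m := by exact_mod_cast hK2
            nlinarith [Nat.cast_nonneg (α := ℝ) K.card]
          calc 6 * S * (2 * K.card / √k - √K.card)
              ≤ 6 * S * (2 * K.card / √k - 7 / 5 * K.card / √m) := by gcongr
            _ = _ := by ring
    refine ⟨X ∪ A, ?_, fun L hL hLc => hAk L (by rwa [sdiff_sdiff_left]) hLc⟩
    have h1 : ((X ∪ A).card : ℝ) ≤ X.card + A.card := by exact_mod_cast Finset.card_union_le _ _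
    have h2 : ((U \ X).card : ℝ) ≤ m := by exact_mod_cast Finset.card_le_card Finset.sdiff_subset
    have h3 : (A.card : ℝ) ≤ 6 * S * (2 / √k - 7 / 5 / √m) * m := hA.trans (by gcongr)
    have h4 : (m : ℝ) / √m = √m := Real.div_sqrt
    have h5 : 6 * S * (2 / √k - 7 / 5 / √m) * m = 6 * S * (2 * m / √k - 7 / 5 * √m) := by
      linear_combination (-42 / 5) * S * h4
    have h6 : 0 ≤ S * √m := by positivity
    rw [h5] at h3
    linarith

/-- The vertex decomposition in terms of `ConnectedOn`. -/
theorem exists_vertex_decomposition [Fintype V] {r : ℕ} {H : SimpleGraph (Fin r)}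
    (hG : ¬ HasMinor G H) {k : ℕ} (hk : 0 < k) :
    ∃ A : Finset V, (A.card : ℝ) ≤ 12 * Fintype.card V * (r * √r) / √k ∧
      ∀ L : Finset V, Disjoint L A → ConnectedOn G L → L.card ≤ k := by
  obtain ⟨n, hn⟩ : ∃ n, Fintype.card V = n := ⟨_, rfl⟩
  rw [hn]
  rcases le_or_gt n k with hnk | hnk
  · exact ⟨∅, by simp only [Finset.card_empty, Nat.cast_zero]; positivity,
      fun L _ _ => (Finset.card_le_univ L).trans (hn ▸ hnk)⟩
  · obtain ⟨A, hA, hAk⟩ := exists_splitting hG hk Finset.univ (by rwa [Finset.card_univ, hn])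
    rw [Finset.card_univ, hn] at hA
    refine ⟨A, hA.trans ?_, fun L hL => hAk L fun x hx =>
      Finset.mem_sdiff.2 ⟨Finset.mem_univ x, Finset.disjoint_left.1 hL hx⟩⟩
    calc 6 * (r * √r) * (2 * n / √k - √n) ≤ 6 * (r * √r) * (2 * n / √k) := by
          gcongr
          exact sub_le_self _ (Real.sqrt_nonneg _)
      _ = _ := by ring

end Separators

/-- Alon–Seymour–Thomas: an `H`-minor-free graph has, for every `k`, a set of at
most `α n r^{3/2} / k^{1/2}` vertices whose removal leaves components of size at most `k`. -/
theorem ast_vertex_decomposition :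
    ∃ α : ℝ, 0 < α ∧
      ∀ (r n d : ℕ) (H : SimpleGraph (Fin r))
        (V : Type) [Fintype V] [DecidableEq V]
        (G : SimpleGraph V) [DecidableRel G.Adj],
        Fintype.card V = n → 1 ≤ d → (∀ v, G.degree v ≤ d) →
        ¬ HasMinor G H →
        ∀ k : ℕ, 0 < k →
          ∃ A : Set V,
            (A.ncard : ℝ) ≤ α * n * (r : ℝ) ^ ((3 : ℝ) / 2) / (k : ℝ) ^ ((1 : ℝ) / 2) ∧
            ∀ c : (G.induce Aᶜ).ConnectedComponent, c.supp.ncard ≤ k := by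
  refine ⟨12, by norm_num, ?_⟩
  intro r n d H V _ _ G _ hn _ _ hG k hk
  obtain ⟨A, hA, hAk⟩ := exists_vertex_decomposition hG hk
  rw [hn] at hA
  refine ⟨A, ?_, fun c => ?_⟩
  · rw [Set.ncard_coe_finset, ← Real.sqrt_eq_rpow]
    have : (r : ℝ) ^ ((3 : ℝ) / 2) = r * √r := by
      rw [Real.sqrt_eq_rpow, show (3 : ℝ) / 2 = 1 + 1 / 2 by norm_num,
        Real.rpow_add' (by positivity) (by norm_num), Real.rpow_one]
    rwa [this]
  · let L : Finset V := (Subtype.val '' c.supp).toFinset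
    have hL : (L : Set V) = Subtype.val '' c.supp := Set.coe_toFinset _
    rw [← Set.ncard_image_of_injective c.supp Subtype.val_injective, ← hL, Set.ncard_coe_finset]
    refine hAk L (Finset.disjoint_left.2 fun x hx hxA => ?_) (.of_induce_connected ?_)
    · rw [← Finset.mem_coe, hL] at hx
      obtain ⟨y, -, rfl⟩ := hx
      exact y.2 hxA
    · rw [hL]
      have e := c.connected_toSimpleGraph
      have f : c.toSimpleGraph ≃g G.induce (Subtype.val '' c.supp) := by
        refine ⟨Equiv.Set.image Subtype.val c.supp Subtype.val_injective, ?_⟩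
        intro a b
        rfl
      exact f.connected_iff.1 e
end
end
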